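/- arXiv:math/0408203 — 4 statements merged into one kernel-verified Lean document; each statement's English description precedes it below -/
import Mathlib

section
/- Let 0 < γ < λ < 1 and let k ≥ 2 be an integer. If μ_{γ^k, λ^k} is absolutely continuous with respect to Lebesgue measure on ℝ² with a density in L²(ℝ²), then μ_{γ,λ} is absolutely continuous with a continuous density; in particular the support of μ_{γ,λ} has nonempty interior. -/
open MeasureTheory Filter Set
open scoped ENNReal Topology

noncomputable section

/-- `ρ` is the Bernoulli product measure with weights `p`. -/
def IsBernoulliWith {α : Type*} [MeasurableSpace α] (p : α → ℝ≥0∞)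
    (ρ : Measure (ℕ → α)) : Prop :=
  IsProbabilityMeasure ρ ∧
    ∀ (n : ℕ) (w : Fin n → α), ρ {ω | ∀ i : Fin n, ω i.1 = w i} = ∏ i, p (w i)

/-- `Π_{a,b}(ω) = ∑ₙ εₙ (aⁿ, bⁿ)` with `εₙ = ±1` coded by a Boolean sequence. -/
def PiPM (a b : ℝ) (ω : ℕ → Bool) : ℝ × ℝ :=
  (∑' n, (if ω n then (1 : ℝ) else -1) * a ^ n,
   ∑' n, (if ω n then (1 : ℝ) else -1) * b ^ n)

/-- The support set `{x : every open neighbourhood has positive measure}` of a measure. -/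
def measSupport (μ : Measure (ℝ × ℝ)) : Set (ℝ × ℝ) :=
  {x | ∀ U : Set (ℝ × ℝ), IsOpen U → x ∈ U → 0 < μ U}


/-- The fair coin on `Bool`. -/
def coinM : Measure Bool := (2 : ℝ≥0∞)⁻¹ • (Measure.dirac true + Measure.dirac false)

lemma coinM_singleton (b : Bool) : coinM {b} = (2 : ℝ≥0∞)⁻¹ := by
  cases b <;> simp [coinM]

instance : IsProbabilityMeasure coinM := by
  constructor
  simp [coinM, ENNReal.inv_two_add_inv_two]

lemma bern_eq (ρ : Measure (ℕ → Bool)) (hρ : IsBernoulliWith (fun _ => (2 : ℝ≥0∞)⁻¹) ρ) :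
    ρ = Measure.infinitePi (fun _ : ℕ => coinM) := by
  have hp := hρ.1
  have key : ∀ n : ℕ, ρ.map (fun ω (i : Fin n) => ω i.1) =
      (Measure.infinitePi (fun _ : ℕ => coinM)).map (fun ω (i : Fin n) => ω i.1) := by
    intro n
    rw [Measure.map_infinitePi_infinitePi_of_inj Fin.val_injective, Measure.infinitePi_eq_pi]
    apply Measure.ext_of_singleton
    intro w
    rw [Measure.pi_singleton, Measure.map_apply (by fun_prop) (measurableSet_singleton w)]
    simp only [coinM_singleton]
    rw [← hρ.2 n w]
    congr 1
    ext ω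
    simp [funext_iff]
  refine Measure.eq_infinitePi _ fun s t ht => ?_
  rw [← Measure.infinitePi_pi _ (fun i _ => ht i)]
  obtain ⟨n, hn⟩ := s.exists_nat_subset_range
  have hset : Set.pi (s : Set ℕ) t = (fun (ω : ℕ → Bool) (i : Fin n) => ω i.1) ⁻¹'
      {w | ∀ i : Fin n, i.1 ∈ s → w i ∈ t i.1} := by
    ext ω
    simp only [Set.mem_pi, Set.mem_preimage, Set.mem_ofPred_eq]
    constructor
    · intro h i hi; exact h i hi
    · intro h i hi
      exact h ⟨i, by simpa using hn hi⟩ hi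
  have hm : MeasurableSet {w : Fin n → Bool | ∀ i : Fin n, i.1 ∈ s → w i ∈ t i.1} :=
    Set.Finite.measurableSet (Set.toFinite _)
  rw [hset, ← Measure.map_apply (by fun_prop) hm, ← Measure.map_apply (by fun_prop) hm, key]

lemma summ_pm {a : ℝ} (h0 : 0 < a) (h1 : a < 1) (ω : ℕ → Bool) :
    Summable (fun n => (if ω n then (1 : ℝ) else -1) * a ^ n) := by
  refine Summable.of_norm_bounded (summable_geometric_of_lt_one h0.le h1) fun n => ?_
  rw [norm_mul, norm_pow, Real.norm_of_nonneg h0.le]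
  split_ifs <;> simp

lemma cont_pm {a : ℝ} (h0 : 0 < a) (h1 : a < 1) (c : ℕ → ℝ) (hc : ∀ n, |c n| ≤ 1) :
    Continuous (fun ω : ℕ → Bool => ∑' n, c n * ((if ω n then (1 : ℝ) else -1) * a ^ n)) := by
  refine continuous_tsum (u := fun n => a ^ n) (fun n => ?_)
    (summable_geometric_of_lt_one h0.le h1) fun n ω => ?_
  · refine continuous_const.mul (Continuous.mul ?_ continuous_const)
    exact (continuous_of_discreteTopology (f := fun b : Bool => if b then (1 : ℝ) else -1)).comp
      (continuous_apply n)
  · rw [norm_mul, norm_mul, norm_pow, Real.norm_of_nonneg h0.le]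
    have : ‖(if ω n then (1 : ℝ) else -1)‖ = 1 := by split_ifs <;> simp
    rw [this, one_mul]
    exact mul_le_of_le_one_left (by positivity) (hc n)

lemma meas_PiPM {a b : ℝ} (ha : 0 < a) (ha1 : a < 1) (hb : 0 < b) (hb1 : b < 1) :
    Measurable (PiPM a b) := by
  have h1 := (cont_pm ha ha1 (fun _ => 1) (by simp)).measurable
  have h2 := (cont_pm hb hb1 (fun _ => 1) (by simp)).measurable
  simp only [one_mul] at h1 h2
  exact h1.prodMk h2

/-- The remainder of the series over residues other than `0` and `1` modulo `k`. -/
def remPM (k : ℕ) (a : ℝ) (ω : ℕ → Bool) : ℝ :=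
  ∑' n, (if n % k = 0 ∨ n % k = 1 then (0 : ℝ) else 1) * ((if ω n then (1 : ℝ) else -1) * a ^ n)

lemma split_sum {k : ℕ} (hk : 2 ≤ k) {a : ℝ} (h0 : 0 < a) (h1 : a < 1) (ω : ℕ → Bool) :
    ∑' n, (if ω n then (1 : ℝ) else -1) * a ^ n =
      ((∑' n, (if ω (k * n) then (1 : ℝ) else -1) * (a ^ k) ^ n) +
      a * ∑' n, (if ω (k * n + 1) then (1 : ℝ) else -1) * (a ^ k) ^ n) + remPM k a ω := by
  set F : ℕ → ℝ := fun n => (if ω n then (1 : ℝ) else -1) * a ^ n with hF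
  have hs : Summable F := summ_pm h0 h1 ω
  have inj0 : Function.Injective (fun n : ℕ => k * n) := fun x y h => by
    have : k * x = k * y := h
    exact Nat.eq_of_mul_eq_mul_left (by omega) this
  have inj1 : Function.Injective (fun n : ℕ => k * n + 1) := fun x y h => by
    have : k * x + 1 = k * y + 1 := h
    exact Nat.eq_of_mul_eq_mul_left (by omega : 0 < k) (by omega)
  have e0 : ∑' n, (if ω (k * n) then (1 : ℝ) else -1) * (a ^ k) ^ n =
      ∑' n, Set.indicator {n | n % k = 0} F n := by
    rw [← inj0.tsum_eq (f := Set.indicator {n | n % k = 0} F)]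
    · refine tsum_congr fun n => ?_
      simp [hF, Set.indicator, pow_mul]
    · intro n hn
      have : n % k = 0 := by
        by_contra h
        exact hn (by simp [Set.indicator, h])
      exact ⟨n / k, by simpa using Nat.mul_div_cancel' (Nat.dvd_of_mod_eq_zero this)⟩
  have e1 : a * ∑' n, (if ω (k * n + 1) then (1 : ℝ) else -1) * (a ^ k) ^ n =
      ∑' n, Set.indicator {n | n % k = 1} F n := by
    rw [← inj1.tsum_eq (f := Set.indicator {n | n % k = 1} F), ← tsum_mul_left]
    · refine tsum_congr fun n => ?_
      have : (k * n + 1) % k = 1 := by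
        rw [Nat.mul_add_mod]; exact Nat.mod_eq_of_lt (by omega)
      simp only [hF, Set.indicator, Set.mem_ofPred_eq, this, if_true, pow_succ, pow_mul]
      ring
    · intro n hn
      have : n % k = 1 := by
        by_contra h
        exact hn (by simp [Set.indicator, h])
      refine ⟨n / k, ?_⟩
      have := Nat.div_add_mod n k
      simp only
      omega
  have e2 : remPM k a ω = ∑' n, Set.indicator {n | ¬ (n % k = 0 ∨ n % k = 1)} F n := by
    refine tsum_congr fun n => ?_
    simp only [Set.indicator, Set.mem_ofPred_eq, hF]
    by_cases h : (n % k = 0 ∨ n % k = 1)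
    · rw [if_pos h, if_neg (not_not.2 h), zero_mul]
    · rw [if_neg h, if_pos h, one_mul]
  rw [e0, e1, e2, ← (hs.indicator _).tsum_add (hs.indicator _),
    ← ((hs.indicator _).add (hs.indicator _)).tsum_add (hs.indicator _)]
  refine tsum_congr fun n => ?_
  change F n = _
  simp only [Set.indicator, Set.mem_ofPred_eq]
  by_cases hA : n % k = 0 <;> by_cases hB : n % k = 1 <;> simp [hA, hB]

/-- The coordinate `σ`-algebra generated by coordinates in `S`. -/
abbrev coordSA (S : Set ℕ) : MeasurableSpace (ℕ → Bool) :=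
  ⨆ i ∈ S, MeasurableSpace.comap (fun ω : ℕ → Bool => ω i) inferInstance

lemma coordSA_indep {S T : Set ℕ} (h : Disjoint S T) :
    ProbabilityTheory.Indep (coordSA S) (coordSA T) (Measure.infinitePi (fun _ : ℕ => coinM)) := by
  refine ProbabilityTheory.indep_iSup_of_disjoint (fun i => ?_) ?_ h
  · exact (measurable_pi_apply i).comap_le
  · exact ProbabilityTheory.iIndepFun_infinitePi (X := fun _ ω => ω) (fun _ => measurable_id)

lemma coordSA_meas {S : Set ℕ} {i : ℕ} (hi : i ∈ S) :
    @Measurable _ _ (coordSA S) _ (fun ω : ℕ → Bool => ω i) := by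
  have := comap_measurable (m := inferInstance) (fun ω : ℕ → Bool => ω i)
  exact this.mono (le_iSup₂_of_le i hi le_rfl) le_rfl

lemma PiPM_sub_meas {S : Set ℕ} {f : ℕ → ℕ} (hf : ∀ n, f n ∈ S)
    {a b : ℝ} (ha : 0 < a) (ha1 : a < 1) (hb : 0 < b) (hb1 : b < 1) :
    @Measurable _ _ (coordSA S) _ (fun ω : ℕ → Bool => PiPM a b (fun n => ω (f n))) := by
  refine (meas_PiPM ha ha1 hb hb1).comp ?_
  exact @measurable_pi_lambda _ _ _ (coordSA S) _ _ fun n => coordSA_meas (hf n)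

lemma remPM_meas {k : ℕ} {a : ℝ} (ha : 0 < a) (ha1 : a < 1) :
    @Measurable _ _ (coordSA {n | ¬ (n % k = 0 ∨ n % k = 1)}) _ (remPM k a) := by
  classical
  have h1 : Measurable (remPM k a) := (cont_pm ha ha1 _ (fun n => by split_ifs <;> simp)).measurable
  have h2 : remPM k a = (remPM k a) ∘ (fun ω n => if n % k = 0 ∨ n % k = 1 then true else ω n) := by
    funext ω
    refine tsum_congr fun n => ?_
    by_cases h : (n % k = 0 ∨ n % k = 1) <;> simp [h]
  rw [h2]
  refine h1.comp ?_
  refine @measurable_pi_lambda _ _ _ (coordSA _) _ _ fun n => ?_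
  by_cases h : (n % k = 0 ∨ n % k = 1)
  · simp only [h, if_true]; exact measurable_const
  · simp only [h, if_false]
    exact coordSA_meas h

lemma map_scale_volume {a b : ℝ} (ha : 0 < a) (hb : 0 < b) :
    (volume : Measure (ℝ × ℝ)).map (fun p => (a * p.1, b * p.2)) =
      (ENNReal.ofReal a⁻¹ * ENNReal.ofReal b⁻¹) • (volume : Measure (ℝ × ℝ)) := by
  have h := Measure.map_prod_map (volume : Measure ℝ) (volume : Measure ℝ)
    (f := fun x => a * x) (g := fun x => b * x) (by fun_prop) (by fun_prop)
  rw [Real.map_volume_mul_left ha.ne', Real.map_volume_mul_left hb.ne',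
    Measure.prod_smul_left, Measure.prod_smul_right, smul_smul,
    abs_of_pos (inv_pos.2 ha), abs_of_pos (inv_pos.2 hb)] at h
  exact h.symm

lemma scale_density {a b : ℝ} (ha : 0 < a) (hb : 0 < b) {H : ℝ × ℝ → ℝ} (hm : Measurable H)
    (h0 : ∀ x, 0 ≤ H x) (hH : MemLp H 2 volume) :
    ∃ G : ℝ × ℝ → ℝ, Measurable G ∧ (∀ x, 0 ≤ G x) ∧ MemLp G 2 volume ∧
      (volume.withDensity (fun x => ENNReal.ofReal (H x))).map (fun p => (a * p.1, b * p.2)) =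
        volume.withDensity (fun x => ENNReal.ofReal (G x)) := by
  have hT : Measurable (fun p : ℝ × ℝ => (a⁻¹ * p.1, b⁻¹ * p.2)) := by fun_prop
  have hS : Measurable (fun p : ℝ × ℝ => (a * p.1, b * p.2)) := by fun_prop
  have hc : (0:ℝ) ≤ a⁻¹ * b⁻¹ := by positivity
  have hmem : MemLp (fun p : ℝ × ℝ => H (a⁻¹ * p.1, b⁻¹ * p.2)) 2 volume := by
    have : MemLp H 2 ((volume : Measure (ℝ × ℝ)).map (fun p => (a⁻¹ * p.1, b⁻¹ * p.2))) := by
      rw [map_scale_volume (inv_pos.2 ha) (inv_pos.2 hb)]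
      exact hH.smul_measure (by finiteness)
    exact (memLp_map_measure_iff hm.aestronglyMeasurable hT.aemeasurable).1 this
  refine ⟨fun p => (a⁻¹ * b⁻¹) * H (a⁻¹ * p.1, b⁻¹ * p.2), by fun_prop,
    fun x => mul_nonneg hc (h0 _), hmem.const_mul _, ?_⟩
  refine Measure.ext_of_lintegral _ fun φ hφ => ?_
  rw [lintegral_map hφ hS, lintegral_withDensity_eq_lintegral_mul _ (by fun_prop) (by fun_prop),
    lintegral_withDensity_eq_lintegral_mul _ (by fun_prop) hφ]
  have e : ∀ x : ℝ × ℝ, ((fun x => ENNReal.ofReal (H x)) * fun p : ℝ × ℝ => φ (a * p.1, b * p.2)) x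
      = (fun p : ℝ × ℝ => ENNReal.ofReal (H (a⁻¹ * p.1, b⁻¹ * p.2)) * φ p) (a * x.1, b * x.2) := by
    intro x
    simp [ha.ne', hb.ne']
  rw [lintegral_congr e, ← lintegral_map (μ := volume) (g := fun p : ℝ × ℝ => (a * p.1, b * p.2))
    (f := fun p : ℝ × ℝ => ENNReal.ofReal (H (a⁻¹ * p.1, b⁻¹ * p.2)) * φ p) (by fun_prop) hS,
    map_scale_volume ha hb, lintegral_smul_measure, smul_eq_mul,
    ← lintegral_const_mul _ (by fun_prop)]
  refine lintegral_congr fun x => ?_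
  simp only [Pi.mul_apply]
  rw [ENNReal.ofReal_mul hc, ENNReal.ofReal_mul (inv_nonneg.2 ha.le)]
  ring

lemma conv_L2 {H G : ℝ × ℝ → ℝ} (hm : Measurable H) (h0 : ∀ x, 0 ≤ H x) (hH : MemLp H 2 volume)
    (gm : Measurable G) (g0 : ∀ x, 0 ≤ G x) (hG : MemLp G 2 volume) :
    ∃ (F : ℝ × ℝ → ℝ) (C : ℝ), Continuous F ∧ (∀ x, 0 ≤ F x) ∧ (∀ x, F x ≤ C) ∧
      Measure.conv (volume.withDensity (fun x => ENNReal.ofReal (H x)))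
        (volume.withDensity (fun x => ENNReal.ofReal (G x))) =
        volume.withDensity (fun x => ENNReal.ofReal (F x)) := by
  have hG' : MemLp (fun y => G (-y)) 2 volume :=
    hG.comp_measurePreserving (Measure.measurePreserving_neg volume)
  have fac : Fact ((2 : ℝ≥0∞) ≠ ⊤) := ⟨by simp⟩
  set u : Lp ℝ 2 (volume : Measure (ℝ × ℝ)) := hH.toLp H
  set v : Lp ℝ 2 (volume : Measure (ℝ × ℝ)) := hG'.toLp _
  have hGx : ∀ x, MemLp (fun y => G (-y + x)) 2 volume := fun x => by
    have := hG'.comp_measurePreserving (measurePreserving_vadd (-x) (volume : Measure (ℝ × ℝ)))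
    have e : (fun y => G (-y + x)) = (fun y => G (-y)) ∘ fun y => -x +ᵥ y := by
      funext y
      simp
    rw [e]
    exact this
  have hIntg : ∀ x, Integrable (fun y => H y * G (-y + x)) volume := fun x =>
    hH.integrable_mul (hGx x)
  have hval : ∀ x, ∫ y, H y * G (-y + x) = inner ℝ u (DomAddAct.mk (-x) +ᵥ v) := by
    intro x
    rw [L2.inner_def, DomAddAct.mk_vadd_toLp]
    refine integral_congr_ae ?_
    filter_upwards [hH.coeFn_toLp, (hG'.comp_measurePreserving (measurePreserving_vadd (-x)
      (volume : Measure (ℝ × ℝ)))).coeFn_toLp] with y hy1 hy2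
    rw [hy1]
    erw [hy2]
    simp [mul_comm]
  refine ⟨fun x => ∫ y, H y * G (-y + x), ‖u‖ * ‖v‖, ?_, fun x => ?_, fun x => ?_, ?_⟩
  · simp_rw [hval]
    refine continuous_const.inner ?_
    have : Continuous fun x : ℝ × ℝ => DomAddAct.mk (-x) :=
      DomAddAct.continuous_mk.comp continuous_neg
    exact this.vadd continuous_const
  · exact integral_nonneg fun y => mul_nonneg (h0 _) (g0 _)
  · change ∫ y, H y * G (-y + x) ≤ _
    rw [hval]
    refine (real_inner_le_norm _ _).trans ?_
    rw [DomAddAct.norm_vadd_Lp]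
  · rw [conv_withDensity_eq_lconvolution (by fun_prop) (by fun_prop)]
    congr 1
    funext x
    rw [lconvolution_def, ofReal_integral_eq_lintegral_ofReal (hIntg x)
      (Eventually.of_forall fun y => mul_nonneg (h0 _) (g0 _))]
    exact lintegral_congr fun y => (ENNReal.ofReal_mul (h0 y)).symm

lemma conv_prob {F : ℝ × ℝ → ℝ} {C : ℝ} (hF : Continuous F) (h0 : ∀ x, 0 ≤ F x)
    (hC : ∀ x, F x ≤ C) (τ : Measure (ℝ × ℝ)) [IsProbabilityMeasure τ] :
    ∃ f : ℝ × ℝ → ℝ, Continuous f ∧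
      Measure.conv τ (volume.withDensity (fun x => ENNReal.ofReal (F x))) =
        volume.withDensity (fun x => ENNReal.ofReal (f x)) := by
  have hn : ∀ x, ‖F x‖ ≤ C := fun x => by rw [Real.norm_of_nonneg (h0 x)]; exact hC x
  refine ⟨fun x => ∫ r, F (-r + x) ∂τ, ?_, ?_⟩
  · refine continuous_of_dominated (bound := fun _ => C) (fun x => ?_) (fun x => ?_)
      (integrable_const _) ?_
    · exact (hF.comp (by fun_prop)).aestronglyMeasurable
    · exact Eventually.of_forall fun r => hn _
    · exact Eventually.of_forall fun r => hF.comp (by fun_prop)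
  · have hFm := hF.measurable
    have hIntg : ∀ x, Integrable (fun r => F (-r + x)) τ := fun x =>
      (integrable_const C).mono' (hF.comp (by fun_prop)).aestronglyMeasurable
        (Eventually.of_forall fun r => hn _)
    have hfe : ∀ x, ENNReal.ofReal (∫ r, F (-r + x) ∂τ) = ∫⁻ r, ENNReal.ofReal (F (-r + x)) ∂τ :=
      fun x => ofReal_integral_eq_lintegral_ofReal (hIntg x) (Eventually.of_forall fun y => h0 _)
    simp_rw [hfe]
    have hm2 : Measurable (fun x => ∫⁻ r, ENNReal.ofReal (F (-r + x)) ∂τ) :=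
      Measurable.lintegral_prod_right' (f := fun p : (ℝ × ℝ) × (ℝ × ℝ) =>
        ENNReal.ofReal (F (-p.2 + p.1))) (by fun_prop)
    refine Measure.ext_of_lintegral _ fun φ hφ => ?_
    rw [Measure.lintegral_conv hφ, lintegral_withDensity_eq_lintegral_mul _ hm2 hφ]
    have e1 : ∀ r : ℝ × ℝ, ∫⁻ y, φ (r + y) ∂(volume.withDensity fun x => ENNReal.ofReal (F x)) =
        ∫⁻ x, ENNReal.ofReal (F (-r + x)) * φ x := by
      intro r
      rw [lintegral_withDensity_eq_lintegral_mul _ (by fun_prop) (by fun_prop),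
        ← lintegral_add_left_eq_self _ (-r)]
      simp
    simp_rw [e1]
    rw [lintegral_lintegral_swap (by fun_prop)]
    refine lintegral_congr fun x => ?_
    rw [Pi.mul_apply, lintegral_mul_const _ (by fun_prop)]

lemma supp_interior {f : ℝ × ℝ → ℝ} (hf : Continuous f) {μ : Measure (ℝ × ℝ)}
    [IsProbabilityMeasure μ] (h : μ = volume.withDensity (fun x => ENNReal.ofReal (f x))) :
    (interior (measSupport μ)).Nonempty := by
  have hfm := hf.measurable
  have hop : IsOpen {x | 0 < f x} := isOpen_lt continuous_const hf
  have hne : ∃ x, 0 < f x := by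
    by_contra hcon
    push Not at hcon
    have : μ = 0 := by
      rw [h]
      have : (fun x => ENNReal.ofReal (f x)) = 0 := by
        funext x; simpa using hcon x
      rw [this, withDensity_zero]
    exact IsProbabilityMeasure.ne_zero μ this
  obtain ⟨x, hx⟩ := hne
  refine ⟨x, mem_interior.2 ⟨{x | 0 < f x}, ?_, hop, hx⟩⟩
  intro y hy U hU hyU
  rw [pos_iff_ne_zero]
  intro hz
  rw [h, withDensity_apply_eq_zero (by fun_prop)] at hz
  have hpos : 0 < (volume : Measure (ℝ × ℝ)) ({x | 0 < f x} ∩ U) :=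
    (hop.inter hU).measure_pos _ ⟨y, hy, hyU⟩
  refine hpos.ne' (measure_mono_null ?_ hz)
  rintro z ⟨hz1, hz2⟩
  refine ⟨?_, hz2⟩
  simpa using hz1

/-- If `μ_{γ^k,λ^k}` is absolutely continuous with an `L²` density for some `k ≥ 2`, then
`μ_{γ,λ}` is absolutely continuous with a continuous density; in particular the support of
`μ_{γ,λ}` has nonempty interior. -/
theorem continuous_density_of_power_L2
    (ρ : Measure (ℕ → Bool)) (hρ : IsBernoulliWith (fun _ => (2 : ℝ≥0∞)⁻¹) ρ)
    (g l : ℝ) (hg : 0 < g) (hgl : g < l) (hl : l < 1)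
    (k : ℕ) (hk : 2 ≤ k)
    (habs : (ρ.map (PiPM (g ^ k) (l ^ k))) ≪ (volume : Measure (ℝ × ℝ)))
    (hL2 : ∫⁻ x, ((ρ.map (PiPM (g ^ k) (l ^ k))).rnDeriv volume x) ^ 2 < ⊤) :
    (∃ f : ℝ × ℝ → ℝ, Continuous f ∧
        ρ.map (PiPM g l) = volume.withDensity (fun x => ENNReal.ofReal (f x))) ∧
    (interior (measSupport (ρ.map (PiPM g l)))).Nonempty := by
  have hρp := hρ.1
  have hρe := bern_eq ρ hρ
  have hg1 : g < 1 := hgl.trans hl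
  have hl0 : 0 < l := hg.trans hgl
  have hk0 : k ≠ 0 := by omega
  have gk0 : 0 < g ^ k := by positivity
  have gk1 : g ^ k < 1 := pow_lt_one₀ hg.le hg1 hk0
  have lk0 : 0 < l ^ k := by positivity
  have lk1 : l ^ k < 1 := pow_lt_one₀ hl0.le hl hk0
  have hPk := meas_PiPM gk0 gk1 lk0 lk1
  have hP := meas_PiPM hg hg1 hl0 hl
  set ν := ρ.map (PiPM (g ^ k) (l ^ k)) with hν
  have : IsProbabilityMeasure ν := Measure.isProbabilityMeasure_map hPk.aemeasurable
  have : IsProbabilityMeasure (ρ.map (PiPM g l)) :=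
    Measure.isProbabilityMeasure_map hP.aemeasurable
  -- the density
  set H : ℝ × ℝ → ℝ := fun x => (ν.rnDeriv volume x).toReal with hH
  have Hm : Measurable H := (Measure.measurable_rnDeriv _ _).ennreal_toReal
  have H0 : ∀ x, 0 ≤ H x := fun x => ENNReal.toReal_nonneg
  have Hae : (fun x => ENNReal.ofReal (H x)) =ᵐ[volume] ν.rnDeriv volume := by
    filter_upwards [Measure.rnDeriv_lt_top ν volume] with x hx
    exact ENNReal.ofReal_toReal hx.ne
  have Hν : ν = volume.withDensity (fun x => ENNReal.ofReal (H x)) := by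
    rw [withDensity_congr_ae Hae, Measure.withDensity_rnDeriv_eq _ _ habs]
  have HL2 : MemLp H 2 volume := by
    refine ⟨Hm.aestronglyMeasurable, ?_⟩
    rw [eLpNorm_lt_top_iff_lintegral_rpow_enorm_lt_top (by simp) (by simp)]
    refine lt_of_eq_of_lt (lintegral_congr_ae ?_) hL2
    filter_upwards [Hae] with x hx
    rw [Real.enorm_of_nonneg (H0 x), hx]
    simp
  obtain ⟨G, Gm, G0, GL2, Gν⟩ := scale_density hg hl0 Hm H0 HL2
  obtain ⟨F, C, Fc, F0, FC, Fν⟩ := conv_L2 Hm H0 HL2 Gm G0 GL2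
  rw [← Gν, ← Hν] at Fν
  -- the decomposition
  set Y0 : (ℕ → Bool) → ℝ × ℝ := fun ω => PiPM (g ^ k) (l ^ k) (fun n => ω (k * n)) with hY0
  set Y1 : (ℕ → Bool) → ℝ × ℝ := fun ω => PiPM (g ^ k) (l ^ k) (fun n => ω (k * n + 1)) with hY1
  set Z1 : (ℕ → Bool) → ℝ × ℝ := fun ω => (g * (Y1 ω).1, l * (Y1 ω).2) with hZ1
  set R : (ℕ → Bool) → ℝ × ℝ := fun ω => (remPM k g ω, remPM k l ω) with hR
  have hdec : PiPM g l = R + (Y0 + Z1) := by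
    funext ω
    rw [add_comm]
    refine Prod.ext ?_ ?_
    · exact split_sum hk hg hg1 ω
    · exact split_sum hk hl0 hl ω
  have inj0 : Function.Injective (fun n : ℕ => k * n) := fun x y h => by
    have : k * x = k * y := h
    exact Nat.eq_of_mul_eq_mul_left (by omega) this
  have inj1 : Function.Injective (fun n : ℕ => k * n + 1) := fun x y h => by
    have : k * x + 1 = k * y + 1 := h
    exact Nat.eq_of_mul_eq_mul_left (by omega : 0 < k) (by omega)
  have law : ∀ f : ℕ → ℕ, Function.Injective f →
      ρ.map (fun ω => PiPM (g ^ k) (l ^ k) (fun n => ω (f n))) = ν := by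
    intro f hf
    have h1 : ρ.map (fun ω n => ω (f n)) = ρ := by
      conv_lhs => rw [hρe]
      rw [Measure.map_infinitePi_infinitePi_of_inj hf, hρe]
    rw [hν]
    conv_rhs => rw [← h1]
    rw [Measure.map_map hPk (by fun_prop)]
    rfl
  have r0 : ∀ n, k * n % k = 0 := fun n => by simp
  have r1 : ∀ n, (k * n + 1) % k = 1 := fun n => by
    rw [Nat.mul_add_mod]; exact Nat.mod_eq_of_lt (by omega)
  have le_top : ∀ S : Set ℕ, coordSA S ≤ MeasurableSpace.pi := fun S =>
    iSup₂_le fun i _ => (measurable_pi_apply i).comap_le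
  have scm : Measurable (fun p : ℝ × ℝ => (g * p.1, l * p.2)) := by fun_prop
  have m0 : Measurable[coordSA {n | n % k = 0}] Y0 := PiPM_sub_meas r0 gk0 gk1 lk0 lk1
  have m1 : Measurable[coordSA {n | n % k = 1}] Z1 :=
    scm.comp (PiPM_sub_meas r1 gk0 gk1 lk0 lk1)
  have m0' : Measurable[coordSA {n | n % k = 0 ∨ n % k = 1}] Y0 :=
    PiPM_sub_meas (fun n => Or.inl (r0 n)) gk0 gk1 lk0 lk1
  have m1' : Measurable[coordSA {n | n % k = 0 ∨ n % k = 1}] Z1 :=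
    scm.comp (PiPM_sub_meas (fun n => Or.inr (r1 n)) gk0 gk1 lk0 lk1)
  have mR : Measurable[coordSA {n | ¬ (n % k = 0 ∨ n % k = 1)}] R :=
    (remPM_meas (k := k) hg hg1).prodMk (remPM_meas (k := k) hl0 hl)
  have mB : Measurable[coordSA {n | n % k = 0 ∨ n % k = 1}] (Y0 + Z1) :=
    m0'.add m1'
  have M0 : Measurable Y0 := m0.mono (le_top _) le_rfl
  have M1 : Measurable Z1 := m1.mono (le_top _) le_rfl
  have MR : Measurable R := mR.mono (le_top _) le_rfl
  have i01 : ProbabilityTheory.IndepFun Y0 Z1 ρ := by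
    rw [ProbabilityTheory.IndepFun_iff_Indep, hρe]
    refine ProbabilityTheory.indep_of_indep_of_le_left
      (ProbabilityTheory.indep_of_indep_of_le_right (coordSA_indep ?_) m1.comap_le) m0.comap_le
    rw [Set.disjoint_left]
    intro n h h'
    simp only [Set.mem_ofPred_eq] at h h'
    omega
  have iRB : ProbabilityTheory.IndepFun R (Y0 + Z1) ρ := by
    rw [ProbabilityTheory.IndepFun_iff_Indep, hρe]
    refine ProbabilityTheory.indep_of_indep_of_le_left
      (ProbabilityTheory.indep_of_indep_of_le_right (coordSA_indep ?_) mB.comap_le) mR.comap_le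
    rw [Set.disjoint_left]
    intro n h h'
    exact h h'
  have lawZ : ρ.map Z1 = ν.map (fun p => (g * p.1, l * p.2)) := by
    rw [← law _ inj1, Measure.map_map scm (by
      exact (PiPM_sub_meas (S := {n | n % k = 1}) r1 gk0 gk1 lk0 lk1).mono (le_top _) le_rfl)]
    rfl
  have lawB : ρ.map (Y0 + Z1) = volume.withDensity (fun x => ENNReal.ofReal (F x)) := by
    rw [i01.map_add_eq_map_conv_map M0 M1, lawZ, law _ inj0, Fν]
  have : IsProbabilityMeasure (ρ.map R) := Measure.isProbabilityMeasure_map MR.aemeasurable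
  obtain ⟨f, fc, hf⟩ := conv_prob Fc F0 FC (ρ.map R)
  have lawX : ρ.map (PiPM g l) = volume.withDensity (fun x => ENNReal.ofReal (f x)) := by
    rw [hdec, iRB.map_add_eq_map_conv_map MR (M0.add M1), lawB, hf]
  exact ⟨⟨f, fc, lawX⟩, supp_interior fc lawX⟩
end
end

section
/- Let D = {0,1} and 0 < γ, λ < 1. If γλ > 1/2, then the attractor K_{γ,λ} is connected. -/
open MeasureTheory Filter Set
open scoped ENNReal Topology

noncomputable section

/-- The self-affine set `K_{γ,λ}` for the digit set `{0,1}`: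
`K_{γ,λ} = {∑ₙ aₙ(γⁿ, λⁿ) : aₙ ∈ {0,1}}`, the attractor of
`φ₀(x,y) = (γx, λy)`, `φ₁(x,y) = (γx + 1, λy + 1)`. -/
def K01 (g l : ℝ) : Set (ℝ × ℝ) :=
  {p | ∃ a : ℕ → Bool, p = (∑' n, (if a n then (1 : ℝ) else 0) * g ^ n,
                            ∑' n, (if a n then (1 : ℝ) else 0) * l ^ n)}

/-- The two affine maps. -/
def phiMap (g l b : ℝ) (p : ℝ × ℝ) : ℝ × ℝ := (g * p.1 + b, l * p.2 + b)

lemma summable_aux (g : ℝ) (hg0 : 0 < g) (hg1 : g < 1) (a : ℕ → Bool) :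
    Summable (fun n => (if a n then (1 : ℝ) else 0) * g ^ n) := by
  refine Summable.of_nonneg_of_le (fun n => ?_) (fun n => ?_)
    (summable_geometric_of_lt_one hg0.le hg1)
  · split_ifs <;> simp [hg0.le]
  · split_ifs <;> simp [hg0.le]

lemma continuous_aux (g : ℝ) (hg0 : 0 < g) (hg1 : g < 1) :
    Continuous (fun a : ℕ → Bool => ∑' n, (if a n then (1 : ℝ) else 0) * g ^ n) := by
  refine continuous_tsum (fun n => ?_) (summable_geometric_of_lt_one hg0.le hg1) (fun n a => ?_)
  · have h1 : Continuous (fun b : Bool => (if b then (1 : ℝ) else 0) * g ^ n) :=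
      continuous_of_discreteTopology
    exact h1.comp (continuous_apply n)
  · split_ifs <;> simp [abs_of_pos hg0, hg0.le]

lemma K01_eq_range (g l : ℝ) : K01 g l = range (fun a : ℕ → Bool =>
    (∑' n, (if a n then (1 : ℝ) else 0) * g ^ n, ∑' n, (if a n then (1 : ℝ) else 0) * l ^ n)) := by
  ext p
  simp only [K01, mem_ofPred_eq, mem_range, eq_comm]

lemma K01_compact (g l : ℝ) (hg0 : 0 < g) (hg1 : g < 1) (hl0 : 0 < l) (hl1 : l < 1) :
    IsCompact (K01 g l) := by
  rw [K01_eq_range]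
  exact isCompact_range ((continuous_aux g hg0 hg1).prodMk (continuous_aux l hl0 hl1))

lemma tsum_aux (g : ℝ) (hg0 : 0 < g) (hg1 : g < 1) (a : ℕ → Bool) :
    ∑' n, (if a n then (1 : ℝ) else 0) * g ^ n =
      g * (∑' n, (if a (n + 1) then (1 : ℝ) else 0) * g ^ n) + (if a 0 then 1 else 0) := by
  rw [(summable_aux g hg0 hg1 a).tsum_eq_zero_add, ← tsum_mul_left, add_comm]
  congr 1
  · refine tsum_congr fun n => ?_
    ring
  · simp

lemma phi_mem (g l : ℝ) (hg0 : 0 < g) (hg1 : g < 1) (hl0 : 0 < l) (hl1 : l < 1)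
    (b : Bool) {p : ℝ × ℝ} (hp : p ∈ K01 g l) :
    phiMap g l (if b then 1 else 0) p ∈ K01 g l := by
  obtain ⟨a, rfl⟩ := hp
  refine ⟨fun n => Nat.casesOn n b a, ?_⟩
  rw [tsum_aux g hg0 hg1 (fun n => Nat.casesOn n b a),
    tsum_aux l hl0 hl1 (fun n => Nat.casesOn n b a)]
  rfl

lemma mem_phi (g l : ℝ) (hg0 : 0 < g) (hg1 : g < 1) (hl0 : 0 < l) (hl1 : l < 1)
    {p : ℝ × ℝ} (hp : p ∈ K01 g l) :
    ∃ b : Bool, ∃ q ∈ K01 g l, p = phiMap g l (if b then 1 else 0) q := by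
  obtain ⟨a, rfl⟩ := hp
  refine ⟨a 0, _, ⟨fun n => a (n + 1), rfl⟩, ?_⟩
  rw [tsum_aux g hg0 hg1, tsum_aux l hl0 hl1]
  rfl

lemma phi_dist (g l : ℝ) (hg0 : 0 < g) (hl0 : 0 < l) (b : ℝ) (p q : ℝ × ℝ) :
    dist (phiMap g l b p) (phiMap g l b q) ≤ max g l * dist p q := by
  simp only [phiMap, Prod.dist_eq, Real.dist_eq]
  have h1 : g * p.1 + b - (g * q.1 + b) = g * (p.1 - q.1) := by ring
  have h2 : l * p.2 + b - (l * q.2 + b) = l * (p.2 - q.2) := by ring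
  rw [h1, h2, abs_mul, abs_mul, abs_of_pos hg0, abs_of_pos hl0]
  refine max_le ?_ ?_
  · exact mul_le_mul (le_max_left _ _) (le_max_left _ _) (abs_nonneg _) (hg0.le.trans (le_max_left _ _))
  · exact mul_le_mul (le_max_right _ _) (le_max_right _ _) (abs_nonneg _)
      (hg0.le.trans (le_max_left _ _))

lemma phi_volume (g l : ℝ) (hg0 : 0 < g) (hl0 : 0 < l) (b : ℝ) (U : Set (ℝ × ℝ)) :
    volume (phiMap g l b '' U) = ENNReal.ofReal (g * l) * volume U := by
  have e : phiMap g l b = (fun p => p + (b, b)) ∘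
      ((g • (LinearMap.id : ℝ →ₗ[ℝ] ℝ)).prodMap (l • (LinearMap.id : ℝ →ₗ[ℝ] ℝ))) := by
    funext p
    simp [phiMap]
  rw [e, image_comp, image_add_right, measure_preimage_add_right,
    Measure.addHaar_image_linearMap, LinearMap.det_prodMap]
  simp [abs_of_pos hg0, abs_of_pos hl0]

lemma phi_thick (g l : ℝ) (hg0 : 0 < g) (hg1 : g < 1) (hl0 : 0 < l) (hl1 : l < 1) (b δ : ℝ)
    (S : Set (ℝ × ℝ)) :
    phiMap g l b '' (Metric.thickening δ S) ⊆ Metric.thickening δ (phiMap g l b '' S) := by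
  rintro _ ⟨p, hp, rfl⟩
  rw [Metric.mem_thickening_iff] at hp ⊢
  obtain ⟨z, hz, hd⟩ := hp
  refine ⟨_, mem_image_of_mem _ hz, ?_⟩
  have h1 := phi_dist g l hg0 hl0 b p z
  have h2 : max g l < 1 := max_lt hg1 hl1
  nlinarith [dist_nonneg (x := p) (y := z)]

lemma K01_nonempty (g l : ℝ) : (K01 g l).Nonempty := ⟨_, fun _ => false, rfl⟩

lemma phi_continuous (g l b : ℝ) : Continuous (phiMap g l b) := by
  unfold phiMap; fun_prop

lemma overlap (g l : ℝ) (hg0 : 0 < g) (hg1 : g < 1)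
    (hl0 : 0 < l) (hl1 : l < 1) (h : 1 / 2 < g * l) :
    ∃ p ∈ K01 g l, ∃ q ∈ K01 g l, phiMap g l 0 p = phiMap g l 1 q := by
  by_contra hcon
  push Not at hcon
  have hK := K01_compact g l hg0 hg1 hl0 hl1
  have hdis : Disjoint (phiMap g l 0 '' K01 g l) (phiMap g l 1 '' K01 g l) := by
    rw [Set.disjoint_left]
    rintro _ ⟨p, hp, rfl⟩ ⟨q, hq, e⟩
    exact hcon p hp q hq e.symm
  obtain ⟨δ, hδ, hd⟩ := hdis.exists_thickenings (hK.image (phi_continuous g l 0))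
    (hK.image (phi_continuous g l 1)).isClosed
  set U := Metric.thickening δ (K01 g l) with hU
  have hsub0 : phiMap g l 0 '' K01 g l ⊆ K01 g l := by
    rintro _ ⟨p, hp, rfl⟩
    simpa using phi_mem g l hg0 hg1 hl0 hl1 false hp
  have hsub1 : phiMap g l 1 '' K01 g l ⊆ K01 g l := by
    rintro _ ⟨p, hp, rfl⟩
    simpa using phi_mem g l hg0 hg1 hl0 hl1 true hp
  have t0 := phi_thick g l hg0 hg1 hl0 hl1 0 δ (K01 g l)
  have t1 := phi_thick g l hg0 hg1 hl0 hl1 1 δ (K01 g l)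
  have hpos : 0 < volume U :=
    Metric.isOpen_thickening.measure_pos _ 
      ((K01_nonempty g l).mono (Metric.self_subset_thickening hδ _))
  have hfin : volume U ≠ ∞ := (hK.isBounded.thickening).measure_lt_top.ne
  have hm := measure_inter_add_sdiff (μ := volume) U
    (Metric.isOpen_thickening (δ := δ) (E := phiMap g l 0 '' K01 g l)).measurableSet
  have m0 := measure_mono (μ := volume) (subset_inter (t0.trans (Metric.thickening_subset_of_subset δ hsub0)) t0)
  have m1 := measure_mono (μ := volume) (subset_sdiff.2
    ⟨t1.trans (Metric.thickening_subset_of_subset δ hsub1), (hd.mono_right t1).symm⟩)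
  have hle := add_le_add m0 m1
  rw [hm, phi_volume g l hg0 hl0, phi_volume g l hg0 hl0] at hle
  have hle2 := ENNReal.toReal_mono hfin hle
  rw [ENNReal.toReal_add (by finiteness) (by finiteness), ENNReal.toReal_mul,
    ENNReal.toReal_ofReal (by positivity)] at hle2
  have := ENNReal.toReal_pos hpos.ne' hfin
  nlinarith

lemma chain_step (g l : ℝ) (hg0 : 0 < g) (hg1 : g < 1)
    (hl0 : 0 < l) (hl1 : l < 1) (h : 1 / 2 < g * l) (D : ℝ)
    (hD : ∀ x ∈ K01 g l, ∀ y ∈ K01 g l, dist x y ≤ D) (n : ℕ) (S : Set (ℝ × ℝ))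
    (hS : ∀ x ∈ K01 g l, ∀ y ∈ K01 g l, dist x y ≤ max g l ^ n * D → (x ∈ S ↔ y ∈ S)) :
    ∀ x ∈ K01 g l, ∀ y ∈ K01 g l, (x ∈ S ↔ y ∈ S) := by
  induction n generalizing S with
  | zero => exact fun x hx y hy => hS x hx y hy (by simpa using hD x hx y hy)
  | succ n ih =>
    have key : ∀ b : Bool, ∀ x ∈ K01 g l, ∀ y ∈ K01 g l,
        (phiMap g l (if b then 1 else 0) x ∈ S ↔ phiMap g l (if b then 1 else 0) y ∈ S) := by
      intro b
      refine ih (phiMap g l (if b then 1 else 0) ⁻¹' S) fun x hx y hy hxy => ?_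
      refine hS _ (phi_mem g l hg0 hg1 hl0 hl1 b hx) _ (phi_mem g l hg0 hg1 hl0 hl1 b hy) ?_
      refine (phi_dist g l hg0 hl0 _ x y).trans ?_
      rw [pow_succ', mul_assoc]
      exact mul_le_mul_of_nonneg_left hxy (hg0.le.trans (le_max_left _ _))
    obtain ⟨p, hp, q, hq, e⟩ := overlap g l hg0 hg1 hl0 hl1 h
    have all : ∀ x ∈ K01 g l, (x ∈ S ↔ phiMap g l 0 p ∈ S) := by
      intro x hx
      obtain ⟨b, z, hz, rfl⟩ := mem_phi g l hg0 hg1 hl0 hl1 hx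
      cases b
      · simpa using key false z hz p hp
      · rw [e]
        simpa using key true z hz q hq
    exact fun x hx y hy => (all x hx).trans (all y hy).symm

/-- For `D = {0,1}` and `0 < γ, λ < 1`: if `γλ > 1/2` then `K_{γ,λ}` is connected. -/
theorem connected_of_overlap (g l : ℝ) (hg0 : 0 < g) (hg1 : g < 1)
    (hl0 : 0 < l) (hl1 : l < 1) (h : 1 / 2 < g * l) :
    IsConnected (K01 g l) := by
  refine ⟨K01_nonempty g l, ?_⟩
  have hK := K01_compact g l hg0 hg1 hl0 hl1
  rw [isPreconnected_closed_iff]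
  rintro t t' ht ht' hsub ⟨x, hxK, hxt⟩ ⟨y, hyK, hyt⟩
  by_contra hcon
  have hno : ∀ z ∈ K01 g l, z ∈ t → z ∈ t' → False :=
    fun z hz h1 h2 => hcon ⟨z, hz, h1, h2⟩
  have hdis : Disjoint (K01 g l ∩ t) (K01 g l ∩ t') := by
    rw [Set.disjoint_left]
    exact fun z h1 h2 => hno z h1.1 h1.2 h2.2
  obtain ⟨δ, hδ, hd⟩ := hdis.exists_thickenings (hK.inter_right ht) (hK.inter_right ht').isClosed
  have hsep : ∀ u ∈ K01 g l, ∀ v ∈ K01 g l, dist u v < δ → u ∈ t → v ∈ t := by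
    intro u hu v hv huv hut
    rcases hsub hv with hv' | hv'
    · exact hv'
    · exfalso
      have hu1 : u ∈ Metric.thickening δ (K01 g l ∩ t) :=
        Metric.self_subset_thickening hδ _ ⟨hu, hut⟩
      refine Set.disjoint_left.1 hd hu1 ?_
      exact Metric.mem_thickening_iff.2 ⟨v, ⟨hv, hv'⟩, huv⟩
  obtain ⟨D, hD⟩ := Metric.isBounded_iff.1 hK.isBounded
  have hlim : Tendsto (fun n : ℕ => max g l ^ n * D) atTop (𝓝 0) := by
    simpa using (tendsto_pow_atTop_nhds_zero_of_lt_one (hg0.le.trans (le_max_left g l))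
      (max_lt hg1 hl1)).mul_const D
  obtain ⟨n, hn⟩ := (hlim.eventually_lt_const hδ).exists
  have := chain_step g l hg0 hg1 hl0 hl1 h D (fun x hx y hy => hD hx hy) n t
    (fun u hu v hv huv => ⟨hsep u hu v hv (huv.trans_lt hn),
      hsep v hv u hu (by rw [dist_comm]; exact huv.trans_lt hn)⟩) x hxK y hyK
  exact hno y hyK (this.1 hxt) hyt
end
end

section
/- Let D = {0,1} and let (γ,λ) ∈ Γ(0,1/2), i.e. 0 < γ < λ < 1, λ > 1/2 and γλ < 1/2. If there exists a nonzero polynomial P with all coefficients in {−1,0,1} such that P(γ) = P(λ) = 0, then the Hausdorff dimension of K_{γ,λ} is strictly less than 1 + log(2λ)/log(1/γ). -/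
open MeasureTheory Filter Set
open scoped ENNReal Topology

noncomputable section

/-- Points obtained by composing `k` times the maps `q ↦ s + (G q.1, L q.2)`, `s ∈ S`. -/
def levelPts (G L : ℝ) (S : Finset (ℝ × ℝ)) : ℕ → Finset (ℝ × ℝ)
  | 0 => {0}
  | k + 1 => Finset.image₂ (fun s t => (s.1 + G * t.1, s.2 + L * t.2)) S (levelPts G L S k)

lemma levelPts_card (G L : ℝ) (S : Finset (ℝ × ℝ)) (k : ℕ) :
    (levelPts G L S k).card ≤ S.card ^ k := by
  induction k with
  | zero => simp [levelPts]
  | succ k ih =>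
    rw [levelPts, pow_succ']
    exact (Finset.card_image₂_le _ _ _).trans (Nat.mul_le_mul_left _ ih)

lemma levelPts_cover (G L : ℝ) (S : Finset (ℝ × ℝ)) (K : Set (ℝ × ℝ))
    (h : ∀ p ∈ K, ∃ s ∈ S, ∃ q ∈ K, p = (s.1 + G * q.1, s.2 + L * q.2)) (k : ℕ) :
    ∀ p ∈ K, ∃ s ∈ levelPts G L S k, ∃ q ∈ K, p = (s.1 + G ^ k * q.1, s.2 + L ^ k * q.2) := by
  induction k with
  | zero => intro p hp; exact ⟨0, by simp [levelPts], p, hp, by simp⟩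
  | succ k ih =>
    intro p hp
    obtain ⟨s, hs, q, hq, rfl⟩ := h p hp
    obtain ⟨t, ht, q', hq', rfl⟩ := ih q hq
    refine ⟨_, Finset.mem_image₂_of_mem hs ht, q', hq', ?_⟩
    ext <;> simp <;> ring

lemma dimH_le_aux (G L C d : ℝ) (S : Finset (ℝ × ℝ)) (K : Set (ℝ × ℝ)) (hG : 0 < G) (hGL : G < L)
    (hG1 : G < 1) (hC : 0 < C) (hd : 0 ≤ d)
    (hK : ∀ p ∈ K, 0 ≤ p.1 ∧ p.1 ≤ C ∧ 0 ≤ p.2 ∧ p.2 ≤ C)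
    (h : ∀ p ∈ K, ∃ s ∈ S, ∃ q ∈ K, p = (s.1 + G * q.1, s.2 + L * q.2))
    (hr : (S.card : ℝ) * (L / G) * G ^ d ≤ 1) :
    dimH K ≤ ENNReal.ofReal d := by
  have hL : 0 < L := hG.trans hGL
  have key : μH[d] K ≤ ENNReal.ofReal (2 * C ^ d) := by
    let m : ℕ → ℕ := fun k => ⌊(L / G) ^ k⌋₊ + 1
    let t : ∀ k : ℕ, (levelPts G L S k) × Fin (m k) → Set (ℝ × ℝ) := fun k i =>
      {p | i.1.1.1 ≤ p.1 ∧ p.1 ≤ i.1.1.1 + C * G ^ k ∧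
        i.1.1.2 + (i.2 : ℕ) * (C * G ^ k) ≤ p.2 ∧ p.2 ≤ i.1.1.2 + ((i.2 : ℕ) + 1) * (C * G ^ k)}
    have hdiam : ∀ k i, Metric.ediam (t k i) ≤ ENNReal.ofReal (C * G ^ k) := by
      intro k i
      apply Metric.ediam_le_of_forall_dist_le
      rintro x ⟨h1, h2, h3, h4⟩ y ⟨h5, h6, h7, h8⟩
      rw [Prod.dist_eq, Real.dist_eq, Real.dist_eq]
      apply max_le <;> rw [abs_le] <;> constructor <;> linarith
    have hlim : Tendsto (fun k : ℕ => ENNReal.ofReal (C * G ^ k)) atTop (𝓝 0) := by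
      rw [← ENNReal.ofReal_zero]
      apply ENNReal.tendsto_ofReal
      simpa using (tendsto_pow_atTop_nhds_zero_of_lt_one hG.le hG1).const_mul C
    have hcov : ∀ k, K ⊆ ⋃ i, t k i := by
      intro k p hp
      obtain ⟨s, hs, q, hq, rfl⟩ := levelPts_cover G L S K h k p hp
      obtain ⟨h1, h2, h3, h4⟩ := hK q hq
      have hGk : 0 < G ^ k := pow_pos hG k
      have hLk : 0 < L ^ k := pow_pos hL k
      have hCG : 0 < C * G ^ k := by positivity
      set x := L ^ k * q.2 / (C * G ^ k) with hx
      have hx0 : 0 ≤ x := by positivity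
      have hxe : L ^ k * q.2 = x * (C * G ^ k) := by rw [hx]; field_simp
      have hxle : x ≤ (L / G) ^ k := by
        rw [hx, div_pow, div_le_div_iff₀ hCG hGk]
        have := mul_le_mul_of_nonneg_left h4 (mul_pos hLk hGk).le
        linarith
      have hlt : ⌊x⌋₊ < m k := Nat.lt_succ_of_le (Nat.floor_le_floor hxle)
      refine mem_iUnion.2 ⟨(⟨s, hs⟩, ⟨⌊x⌋₊, hlt⟩), ?_⟩
      refine ⟨?_, ?_, ?_, ?_⟩
      · simp only; nlinarith
      · simp only; nlinarith
      · simp only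
        rw [hxe]
        have := mul_le_mul_of_nonneg_right (Nat.floor_le hx0) hCG.le
        linarith
      · simp only
        rw [hxe]
        have := mul_le_mul_of_nonneg_right (Nat.lt_floor_add_one x).le hCG.le
        linarith
    refine (Measure.hausdorffMeasure_le_liminf_sum d K _ hlim t
      (Eventually.of_forall hdiam) (Eventually.of_forall hcov)).trans ?_
    apply liminf_le_of_frequently_le'
    apply Frequently.of_forall
    intro k
    have hGk : 0 < G ^ k := pow_pos hG k
    have hCG : 0 < C * G ^ k := by positivity
    calc ∑ i, Metric.ediam (t k i) ^ d
        ≤ ∑ _i : (levelPts G L S k) × Fin (m k), ENNReal.ofReal ((C * G ^ k) ^ d) := by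
          apply Finset.sum_le_sum
          intro i _
          rw [← ENNReal.ofReal_rpow_of_pos hCG]
          exact ENNReal.rpow_le_rpow (hdiam k i) hd
      _ = ENNReal.ofReal (((levelPts G L S k).card * m k : ℕ) * (C * G ^ k) ^ d) := by
          rw [Finset.sum_const, nsmul_eq_mul, ENNReal.ofReal_mul (by positivity)]
          simp
      _ ≤ _ := by
          apply ENNReal.ofReal_le_ofReal
          have hone : 1 ≤ (L / G) ^ k := one_le_pow₀ ((one_le_div hG).2 hGL.le)
          have hm : (m k : ℝ) ≤ 2 * (L / G) ^ k := by
            have := Nat.floor_le (zero_le_one.trans hone)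
            simp only [m]; push_cast; linarith
          have hc : ((levelPts G L S k).card : ℝ) ≤ (S.card : ℝ) ^ k := by
            exact_mod_cast levelPts_card G L S k
          have hp : (C * G ^ k) ^ d = C ^ d * (G ^ d) ^ k := by
            rw [Real.mul_rpow hC.le hGk.le, ← Real.rpow_natCast, ← Real.rpow_natCast,
              ← Real.rpow_mul hG.le, ← Real.rpow_mul hG.le, mul_comm d]
          rw [hp]
          push_cast
          have hCd : 0 < C ^ d := Real.rpow_pos_of_pos hC d
          have hGd : 0 < G ^ d := Real.rpow_pos_of_pos hG d
          calc ((levelPts G L S k).card : ℝ) * (m k) * (C ^ d * (G ^ d) ^ k)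
              ≤ (S.card : ℝ) ^ k * (2 * (L / G) ^ k) * (C ^ d * (G ^ d) ^ k) := by gcongr
            _ = 2 * C ^ d * ((S.card : ℝ) * (L / G) * G ^ d) ^ k := by
                rw [mul_pow, mul_pow]; ring
            _ ≤ 2 * C ^ d * 1 := by
                gcongr
                exact pow_le_one₀ (by positivity) hr
            _ = _ := by ring
  have : dimH K ≤ (d.toNNReal : ℝ≥0∞) := by
    apply dimH_le_of_hausdorffMeasure_ne_top
    rw [Real.coe_toNNReal d hd]
    exact ne_top_of_le_ne_top ENNReal.ofReal_ne_top key
  exact this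

lemma digit_summable (x : ℝ) (h0 : 0 < x) (h1 : x < 1) (a : ℕ → Bool) :
    Summable (fun n => (if a n then (1 : ℝ) else 0) * x ^ n) := by
  refine Summable.of_nonneg_of_le (fun n => ?_) (fun n => ?_) (summable_geometric_of_lt_one h0.le h1)
  · split_ifs <;> simp [h0.le]
  · split_ifs <;> simp [h0.le]

lemma digit_bounds (x : ℝ) (h0 : 0 < x) (h1 : x < 1) (a : ℕ → Bool) :
    0 ≤ ∑' n, (if a n then (1 : ℝ) else 0) * x ^ n ∧
    ∑' n, (if a n then (1 : ℝ) else 0) * x ^ n ≤ (1 - x)⁻¹ := by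
  constructor
  · apply tsum_nonneg; intro n; split_ifs <;> simp [h0.le]
  · rw [← tsum_geometric_of_lt_one h0.le h1]
    apply (digit_summable x h0 h1 a).tsum_le_tsum _ (summable_geometric_of_lt_one h0.le h1)
    intro n; split_ifs <;> simp [h0.le]

lemma digit_split (x : ℝ) (h0 : 0 < x) (h1 : x < 1) (a : ℕ → Bool) (N : ℕ) :
    ∑' n, (if a n then (1 : ℝ) else 0) * x ^ n =
      ∑ n : Fin N, (if a n then (1 : ℝ) else 0) * x ^ (n : ℕ) +
        x ^ N * ∑' n, (if a (n + N) then (1 : ℝ) else 0) * x ^ n := by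
  rw [← (digit_summable x h0 h1 a).sum_add_tsum_nat_add N, ← tsum_mul_left,
    ← Fin.sum_univ_eq_sum_range (fun n => (if a n then (1 : ℝ) else 0) * x ^ n)]
  congr 1
  apply tsum_congr; intro n; rw [pow_add]; ring

lemma digit_coincide (x : ℝ) (P : Polynomial ℝ)
    (hcoeff : ∀ n : ℕ, P.coeff n = 0 ∨ P.coeff n = 1 ∨ P.coeff n = -1) (hx : P.eval x = 0) :
    ∑ n : Fin (P.natDegree + 1),
        (if decide (P.coeff n = 1) then (1 : ℝ) else 0) * x ^ (n : ℕ) =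
    ∑ n : Fin (P.natDegree + 1),
        (if decide (P.coeff n = -1) then (1 : ℝ) else 0) * x ^ (n : ℕ) := by
  rw [← sub_eq_zero, ← Finset.sum_sub_distrib]
  refine Eq.trans ?_ hx
  rw [Polynomial.eval_eq_sum_range, ← Fin.sum_univ_eq_sum_range (fun n => P.coeff n * x ^ n)]
  apply Finset.sum_congr rfl
  intro n _
  rcases hcoeff n with h | h | h <;> rw [h] <;> norm_num

/-- If `(γ,λ) ∈ Γ(0,1/2)` and `γ`, `λ` are common roots of a nonzero polynomial with
coefficients in `{−1,0,1}`, then `dim_H K_{γ,λ} < 1 + log(2λ)/log(1/γ)`. -/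
theorem dimension_drop_of_polynomial_coincidence
    (g l : ℝ) (hg0 : 0 < g) (hgl : g < l) (hl1 : l < 1)
    (hl : 1 / 2 < l) (hprod : g * l < 1 / 2)
    (P : Polynomial ℝ) (hP : P ≠ 0)
    (hcoeff : ∀ n : ℕ, P.coeff n = 0 ∨ P.coeff n = 1 ∨ P.coeff n = -1)
    (hg : P.eval g = 0) (hlroot : P.eval l = 0) :
    dimH (K01 g l) < ENNReal.ofReal (1 + Real.log (2 * l) / Real.log (1 / g)) := by
  have hl0 : 0 < l := hg0.trans hgl
  have hg1 : g < 1 := hgl.trans hl1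
  obtain ⟨N, hN⟩ : ∃ N, N = P.natDegree + 1 := ⟨_, rfl⟩
  have hN0 : N ≠ 0 := by omega
  let F : (Fin N → Bool) → ℝ × ℝ := fun a =>
    (∑ n : Fin N, (if a n then (1 : ℝ) else 0) * g ^ (n : ℕ),
     ∑ n : Fin N, (if a n then (1 : ℝ) else 0) * l ^ (n : ℕ))
  let S : Finset (ℝ × ℝ) := Finset.univ.image F
  have hScard : S.card < 2 ^ N := by
    have hle : S.card ≤ (Finset.univ : Finset (Fin N → Bool)).card := Finset.card_image_le
    have hcard : (Finset.univ : Finset (Fin N → Bool)).card = 2 ^ N := by simp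
    rw [← hcard]
    refine lt_of_le_of_ne hle fun heq => ?_
    have hinj := Finset.card_image_iff.1 heq
    have huv : (fun n : Fin N => decide (P.coeff n = 1)) =
        (fun n : Fin N => decide (P.coeff n = -1)) := by
      apply hinj (by simp) (by simp)
      subst hN
      exact Prod.ext (digit_coincide g P hcoeff hg) (digit_coincide l P hcoeff hlroot)
    have h2 := congrFun huv ⟨P.natDegree, by omega⟩
    have hlead : P.coeff P.natDegree ≠ 0 := by simpa using hP
    rcases hcoeff P.natDegree with h | h | h
    · exact hlead h
    · simp only [h] at h2; norm_num at h2
    · simp only [h] at h2; norm_num at h2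
  have hSpos : 0 < S.card := Finset.card_pos.2 (Finset.univ_nonempty.image F)
  have hlogg : 0 < Real.log (1 / g) := Real.log_pos ((one_lt_div hg0).2 hg1)
  have hloglg : 0 < Real.log (l / g) := Real.log_pos ((one_lt_div hg0).2 hgl)
  have hNr : (0 : ℝ) < N := by exact_mod_cast Nat.pos_of_ne_zero hN0
  have hSr : (0 : ℝ) < S.card := by exact_mod_cast hSpos
  have hlogS : 0 ≤ Real.log S.card := Real.log_natCast_nonneg _
  have hlogS2 : Real.log S.card < N * Real.log 2 := by
    rw [← Real.log_pow]
    exact Real.log_lt_log hSr (by exact_mod_cast hScard)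
  let d : ℝ := (Real.log S.card / N + Real.log (l / g)) / Real.log (1 / g)
  have hd : 0 ≤ d := by positivity
  have hds : d < 1 + Real.log (2 * l) / Real.log (1 / g) := by
    have h1 : Real.log S.card / N < Real.log 2 := by
      rw [div_lt_iff₀ hNr]; linarith
    have h2 : 1 + Real.log (2 * l) / Real.log (1 / g)
        = (Real.log 2 + Real.log (l / g)) / Real.log (1 / g) := by
      rw [eq_div_iff hlogg.ne', add_mul, div_mul_cancel₀ _ hlogg.ne', Real.log_mul two_ne_zero hl0.ne',
        Real.log_div hl0.ne' hg0.ne', one_div, Real.log_inv]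
      ring
    rw [h2]
    exact div_lt_div_of_pos_right (by linarith) hlogg
  refine lt_of_le_of_lt ?_ ((ENNReal.ofReal_lt_ofReal_iff (hd.trans_lt hds)).2 hds)
  refine dimH_le_aux (g ^ N) (l ^ N) ((1 - l)⁻¹) d S _ (pow_pos hg0 N)
    (pow_lt_pow_left₀ hgl hg0.le hN0) (pow_lt_one₀ hg0.le hg1 hN0) (inv_pos.2 (by linarith)) hd
    ?_ ?_ ?_
  · rintro p ⟨a, rfl⟩
    obtain ⟨h1, h2⟩ := digit_bounds g hg0 hg1 a
    obtain ⟨h3, h4⟩ := digit_bounds l hl0 hl1 a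
    exact ⟨h1, h2.trans (inv_anti₀ (by linarith) (by linarith)), h3, h4⟩
  · rintro p ⟨a, rfl⟩
    refine ⟨F (fun n => a n), Finset.mem_image_of_mem _ (Finset.mem_univ _), _,
      ⟨fun n => a (n + N), rfl⟩, ?_⟩
    exact Prod.ext (digit_split g hg0 hg1 a N) (digit_split l hl0 hl1 a N)
  · have hgN : (0 : ℝ) < g ^ N := pow_pos hg0 N
    have hlN : (0 : ℝ) < l ^ N := pow_pos hl0 N
    have hgd : 0 < (g ^ N) ^ d := Real.rpow_pos_of_pos hgN d
    apply le_of_eq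
    apply Real.eq_one_of_pos_of_log_eq_zero (by positivity)
    rw [Real.log_mul (by positivity) hgd.ne', Real.log_mul hSr.ne' (by positivity),
      Real.log_rpow hgN, ← div_pow, Real.log_pow, Real.log_pow]
    have hdd : d * Real.log (1 / g) = Real.log S.card / N + Real.log (l / g) :=
      div_mul_cancel₀ _ hlogg.ne'
    rw [one_div, Real.log_inv] at hdd
    have : d * (N * Real.log g) = - (N * (Real.log S.card / N + Real.log (l / g))) := by
      rw [← hdd]; ring
    rw [this]
    field_simp
    ring
end
end

section
/- Let D = {0,1,…,m−1} with m ≥ 2, and let R ⊂ Γ(0,1/m) be a region of ⋆-transversality: for every (γ,λ) ∈ R there exists f ∈ 𝓑 with f(γ) = f(λ) = 0 but f′(γ) ≠ 0 and f′(λ) ≠ 0. Then for Lebesgue-almost every (γ,λ) ∈ R, the d(γ,λ)-dimensional Hausdorff measure of K_{γ,λ} is zero, where d(γ,λ) = 1 + log(mλ)/log(1/γ). -/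
open MeasureTheory Filter Set
open scoped ENNReal Topology

noncomputable section

/-- The self-affine set `K_{γ,λ}` for a digit set `d : Fin m → ℝ`. -/
def Kaff (m : ℕ) (d : Fin m → ℝ) (g l : ℝ) : Set (ℝ × ℝ) :=
  {p | ∃ ω : ℕ → Fin m, p = (∑' n, d (ω n) * g ^ n, ∑' n, d (ω n) * l ^ n)}

/-- `Γ(a,b) = {(γ,λ) : 0 < γ < λ < 1, 1/m < λ, a < γλ < b}`. -/
def Gamma (m : ℕ) (a b : ℝ) : Set (ℝ × ℝ) :=
  {p | 0 < p.1 ∧ p.1 < p.2 ∧ p.2 < 1 ∧ 1 / (m : ℝ) < p.2 ∧ a < p.1 * p.2 ∧ p.1 * p.2 < b}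

/-- Evaluation of the power series with coefficient sequence `c` at `x`. -/
def Beval (c : ℕ → ℝ) (x : ℝ) : ℝ := ∑' n, c n * x ^ n

/-- Membership in `𝓑̃`: all coefficients lie in `D − D`. -/
def memBtilde (m : ℕ) (d : Fin m → ℝ) (c : ℕ → ℝ) : Prop :=
  ∀ n, ∃ i j, c n = d i - d j

/-- Membership in `𝓑`: all coefficients lie in `D − D` and the constant term is nonzero. -/
def memB (m : ℕ) (d : Fin m → ℝ) (c : ℕ → ℝ) : Prop :=
  memBtilde m d c ∧ c 0 ≠ 0


/-- The `s`-dimensional Hausdorff content. -/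
def hcont (s : ℝ) (hs : 0 < s) : OuterMeasure (ℝ × ℝ) :=
  OuterMeasure.ofFunction (fun A => Metric.ediam A ^ s) (by simp [hs])

lemma hausdorff_zero_of_hcont {s : ℝ} (hs : 0 < s) {A : Set (ℝ × ℝ)} (h : hcont s hs A = 0) :
    μH[s] A = 0 := by
  rw [Measure.hausdorffMeasure_apply]
  simp only [ENNReal.iSup_eq_zero]
  intro r hr
  rw [← nonpos_iff_eq_zero]
  refine ENNReal.le_of_forall_pos_le_add ?_
  intro ε hε _
  rw [zero_add]
  have hpos : 0 < min (ε : ℝ≥0∞) (r ^ s) :=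
    lt_min (by exact_mod_cast hε) (ENNReal.rpow_pos_of_nonneg hr hs.le)
  rw [hcont, OuterMeasure.ofFunction_apply] at h
  rw [← h] at hpos
  simp only [iInf_lt_iff] at hpos
  obtain ⟨t, ht, hsum⟩ := hpos
  refine iInf_le_of_le t (iInf_le_of_le ht (iInf_le_of_le ?_ ?_))
  · intro n
    have h1 : Metric.ediam (t n) ^ s ≤ r ^ s :=
      (ENNReal.le_tsum n).trans (hsum.le.trans (min_le_right _ _))
    exact (ENNReal.rpow_le_rpow_iff hs).1 h1
  · refine le_trans (ENNReal.tsum_le_tsum fun n => ?_) (hsum.le.trans (min_le_left _ _))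
    exact iSup_le fun _ => le_rfl

lemma hcont_rect (m : ℕ) (hm : 2 ≤ m) {s g l : ℝ} (hs : 0 < s) (hg : 0 < g) (hgl : g < l)
    (hrel : (m : ℝ) * l * g ^ s = g) {C : ℝ} (hC : 0 < C) (a b : ℝ) (k : ℕ) :
    hcont s hs (Icc a (a + C * g ^ k) ×ˢ Icc b (b + C * l ^ k)) ≤
      ENNReal.ofReal (2 * C ^ s * (1 / (m : ℝ)) ^ k) := by
  have hgk : 0 < g ^ k := pow_pos hg k
  have hw : 0 < C * g ^ k := mul_pos hC hgk
  have hm0 : (0 : ℝ) < m := by positivity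
  set N := ⌊(l / g) ^ k⌋₊ with hN
  have h1 : 1 ≤ (l / g) ^ k := one_le_pow₀ ((one_le_div hg).2 hgl.le)
  have hNle : ((N : ℝ) + 1) ≤ 2 * (l / g) ^ k := by
    have := Nat.floor_le (zero_le_one.trans h1)
    linarith
  have hcov : (Icc a (a + C * g ^ k) ×ˢ Icc b (b + C * l ^ k)) ⊆
      ⋃ j ∈ Finset.range (N + 1), Icc a (a + C * g ^ k) ×ˢ
        Icc (b + j * (C * g ^ k)) (b + (j + 1) * (C * g ^ k)) := by
    rintro ⟨x, y⟩ ⟨hx, hy1, hy2⟩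
    simp only at hy1 hy2
    have ht0 : 0 ≤ (y - b) / (C * g ^ k) := div_nonneg (by linarith) hw.le
    have ht1 : (y - b) / (C * g ^ k) ≤ (l / g) ^ k := by
      rw [div_le_iff₀ hw, div_pow]
      have : l ^ k / g ^ k * (C * g ^ k) = C * l ^ k := by field_simp
      linarith
    simp only [mem_iUnion]
    refine ⟨⌊(y - b) / (C * g ^ k)⌋₊, ?_, hx, ?_, ?_⟩
    · rw [Finset.mem_range]
      exact Nat.lt_succ_of_le (Nat.floor_le_floor ht1)
    · have := Nat.floor_le ht0
      rw [le_div_iff₀ hw] at this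
      simp only; linarith
    · have := (Nat.lt_floor_add_one ((y - b) / (C * g ^ k))).le
      rw [div_le_iff₀ hw] at this
      simp only; linarith
  have hpiece : ∀ j : ℕ, hcont s hs (Icc a (a + C * g ^ k) ×ˢ
        Icc (b + j * (C * g ^ k)) (b + (j + 1) * (C * g ^ k))) ≤
        ENNReal.ofReal ((C * g ^ k) ^ s) := by
    intro j
    refine (OuterMeasure.ofFunction_le _).trans ?_
    rw [← ENNReal.ofReal_rpow_of_pos hw]
    refine ENNReal.rpow_le_rpow ?_ hs.le
    refine Metric.ediam_le ?_
    rintro ⟨x, y⟩ ⟨⟨hx1, hx2⟩, hy1, hy2⟩ ⟨x', y'⟩ ⟨⟨hx1', hx2'⟩, hy1', hy2'⟩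
    simp only at *
    rw [Prod.edist_eq, edist_dist, edist_dist, Real.dist_eq, Real.dist_eq]
    refine max_le (ENNReal.ofReal_le_ofReal ?_) (ENNReal.ofReal_le_ofReal ?_)
    · rw [abs_le]; constructor <;> linarith
    · rw [abs_le]; constructor <;> linarith
  refine (measure_mono hcov).trans ((measure_biUnion_finset_le _ _).trans
    ((Finset.sum_le_sum fun j _ => hpiece j).trans ?_))
  rw [Finset.sum_const, Finset.card_range, nsmul_eq_mul, ← ENNReal.ofReal_natCast,
    ← ENNReal.ofReal_mul (by positivity)]
  refine ENNReal.ofReal_le_ofReal ?_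
  push_cast
  have hgs : g ^ s / g = 1 / (m * l) := by
    have : 0 < l := hg.trans hgl
    field_simp
    linarith
  have hpow : (C * g ^ k) ^ s = C ^ s * (g ^ s) ^ k := by
    rw [Real.mul_rpow hC.le hgk.le, ← Real.rpow_natCast, ← Real.rpow_mul hg.le, mul_comm (k : ℝ) s,
      Real.rpow_mul hg.le, Real.rpow_natCast]
  rw [hpow]
  have hfin : 2 * (l / g) ^ k * (C ^ s * (g ^ s) ^ k) = 2 * C ^ s * (1 / (m : ℝ)) ^ k := by
    have : l / g * g ^ s = 1 / m := by
      have : 0 < l := hg.trans hgl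
      field_simp
      linarith
    rw [← this, mul_pow]; ring
  rw [← hfin]
  exact mul_le_mul_of_nonneg_right hNle (by positivity)

/-- Value of a finite word. -/
def wval {m n : ℕ} (u : Fin n → Fin m) (x : ℝ) : ℝ := ∑ i, ((u i).1 : ℝ) * x ^ (i.1)

lemma wval_append {m n k : ℕ} (u : Fin n → Fin m) (v : Fin k → Fin m) (x : ℝ) :
    wval (Fin.append u v) x = wval u x + x ^ n * wval v x := by
  simp only [wval, Fin.sum_univ_add, Fin.append_left, Fin.append_right, Finset.mul_sum,
    Fin.val_castAdd, Fin.val_natAdd]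
  congr 1
  refine Finset.sum_congr rfl fun i _ => ?_
  rw [pow_add]; ring

/-- Pairs of distinct words with arbitrarily close values. -/
def Close (m : ℕ) (g l ε : ℝ) : Prop :=
  ∃ (n : ℕ) (u v : Fin n → Fin m), u ≠ v ∧ |wval u g - wval v g| < ε * g ^ n ∧
    |wval u l - wval v l| < ε * l ^ n

lemma cluster {m : ℕ} {g l : ℝ} (hg : 0 < g) (hl : 0 < l)
    (hclose : ∀ ε > 0, Close m g l ε) (k : ℕ) : ∀ ε > 0, ∃ (n : ℕ) (U : Finset (Fin n → Fin m)),
      U.card = 2 ^ k ∧ ∀ u ∈ U, ∀ v ∈ U, |wval u g - wval v g| ≤ ε * g ^ n ∧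
        |wval u l - wval v l| ≤ ε * l ^ n := by
  induction k with
  | zero =>
    intro ε hε
    refine ⟨0, {fun i => i.elim0}, by simp, ?_⟩
    intro u hu v hv
    simp only [Finset.mem_singleton] at hu hv
    subst hu; subst hv
    simp [hε.le]
  | succ k ih =>
    intro ε hε
    obtain ⟨n, U, hU, hUc⟩ := ih (ε / 2) (by positivity)
    have hδ : 0 < min (ε / 2 * g ^ n) (ε / 2 * l ^ n) := by positivity
    obtain ⟨p, a, b, hab, hag, hal⟩ := hclose _ hδ
    have hinj : ∀ c : Fin p → Fin m, Function.Injective (fun u : Fin n → Fin m => Fin.append c u) := by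
      intro c u v h
      funext i
      have := congrFun h (Fin.natAdd p i)
      simpa using this
    have hdisj : Disjoint (U.image (fun u => Fin.append a u)) (U.image (fun u => Fin.append b u)) := by
      rw [Finset.disjoint_left]
      intro x hx hx'
      obtain ⟨u, -, rfl⟩ := Finset.mem_image.1 hx
      obtain ⟨v, -, h⟩ := Finset.mem_image.1 hx'
      apply hab
      funext i
      have := congrFun h (Fin.castAdd n i)
      simpa using this.symm
    refine ⟨p + n, U.image (fun u => Fin.append a u) ∪ U.image (fun u => Fin.append b u), ?_, ?_⟩
    · rw [Finset.card_union_of_disjoint hdisj, Finset.card_image_of_injective _ (hinj a),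
        Finset.card_image_of_injective _ (hinj b), hU]
      ring
    · have key : ∀ x : ℝ, 0 < x → |wval a x - wval b x| ≤ ε / 2 * x ^ n * x ^ p →
          ∀ c ∈ ({a, b} : Set _), ∀ d ∈ ({a, b} : Set _), ∀ u v : Fin n → Fin m,
          |wval u x - wval v x| ≤ ε / 2 * x ^ n →
          |wval (Fin.append c u) x - wval (Fin.append d v) x| ≤ ε * x ^ (p + n) := by
        intro x hx h c hc d hd u v huv
        have h1 : |wval c x - wval d x| ≤ ε / 2 * x ^ n * x ^ p := by
          have h0 : 0 ≤ ε / 2 * x ^ n * x ^ p := by positivity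
          rcases hc with rfl | rfl <;> rcases hd with rfl | rfl
          · simpa using h0
          · exact h
          · rw [abs_sub_comm]; exact h
          · simpa using h0
        rw [wval_append, wval_append]
        have h2 : |x ^ p * (wval u x - wval v x)| ≤ x ^ p * (ε / 2 * x ^ n) := by
          rw [abs_mul, abs_of_pos (pow_pos hx p)]
          exact mul_le_mul_of_nonneg_left huv (pow_pos hx p).le
        calc _ = |(wval c x - wval d x) + x ^ p * (wval u x - wval v x)| := by congr 1; ring
          _ ≤ _ := abs_add_le _ _
          _ ≤ _ := add_le_add h1 h2
          _ = _ := by rw [pow_add]; ring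
      have hg' : |wval a g - wval b g| ≤ ε / 2 * g ^ n * g ^ p :=
        hag.le.trans (mul_le_mul_of_nonneg_right (min_le_left _ _) (by positivity))
      have hl' : |wval a l - wval b l| ≤ ε / 2 * l ^ n * l ^ p :=
        hal.le.trans (mul_le_mul_of_nonneg_right (min_le_right _ _) (by positivity))
      have hmem : ∀ w ∈ U.image (fun u => Fin.append a u) ∪ U.image (fun u => Fin.append b u),
          ∃ c ∈ ({a, b} : Set _), ∃ u ∈ U, w = Fin.append c u := by
        intro w hw
        rcases Finset.mem_union.1 hw with h | h <;> obtain ⟨u, hu, rfl⟩ := Finset.mem_image.1 h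
        · exact ⟨a, by simp, u, hu, rfl⟩
        · exact ⟨b, by simp, u, hu, rfl⟩
      intro w hw w' hw'
      obtain ⟨c, hc, u, hu, rfl⟩ := hmem w hw
      obtain ⟨d, hd, v, hv, rfl⟩ := hmem w' hw'
      exact ⟨key g hg hg' c hc d hd u v (hUc u hu v hv).1,
        key l hl hl' c hc d hd u v (hUc u hu v hv).2⟩

lemma digit_summable_s19 {m : ℕ} (ω : ℕ → Fin m) {x : ℝ} (hx : 0 < x) (hx1 : x < 1) :
    Summable (fun n => ((ω n).1 : ℝ) * x ^ n) := by
  refine Summable.of_nonneg_of_le (fun n => by positivity) (fun n => ?_)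
    ((summable_geometric_of_lt_one hx.le hx1).mul_left (m : ℝ))
  have : ((ω n).1 : ℝ) ≤ m := by exact_mod_cast (ω n).2.le
  exact mul_le_mul_of_nonneg_right this (by positivity)

lemma digit_bound {m : ℕ} (ω : ℕ → Fin m) {x : ℝ} (hx : 0 < x) (hx1 : x < 1) :
    0 ≤ ∑' n, ((ω n).1 : ℝ) * x ^ n ∧ ∑' n, ((ω n).1 : ℝ) * x ^ n ≤ m * (1 - x)⁻¹ := by
  refine ⟨tsum_nonneg fun n => by positivity, ?_⟩
  rw [← tsum_geometric_of_lt_one hx.le hx1, ← tsum_mul_left]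
  refine (digit_summable_s19 ω hx hx1).tsum_le_tsum (fun n => ?_)
    ((summable_geometric_of_lt_one hx.le hx1).mul_left (m : ℝ))
  have : ((ω n).1 : ℝ) ≤ m := by exact_mod_cast (ω n).2.le
  exact mul_le_mul_of_nonneg_right this (by positivity)

lemma digit_split_s19 {m : ℕ} (ω : ℕ → Fin m) {x : ℝ} (hx : 0 < x) (hx1 : x < 1) (n : ℕ) :
    ∑' i, ((ω i).1 : ℝ) * x ^ i = wval (fun i : Fin n => ω i) x +
      x ^ n * ∑' i, ((ω (i + n)).1 : ℝ) * x ^ i := by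
  rw [← (digit_summable_s19 ω hx hx1).sum_add_tsum_nat_add n, wval, ← tsum_mul_left]
  congr 1
  · rw [Finset.sum_range]
  · congr 1; funext i; rw [pow_add]; ring

/-- Affine copy of `K`. -/
def cell (m : ℕ) (g l : ℝ) (k : ℕ) (a b : ℝ) : Set (ℝ × ℝ) :=
  (fun p : ℝ × ℝ => (a + g ^ k * p.1, b + l ^ k * p.2)) '' Kaff m (fun i => (i.1 : ℝ)) g l

lemma cell_subset_rect {m : ℕ} {g l : ℝ} (hg : 0 < g) (hgl : g < l) (hl : l < 1)
    (k : ℕ) (a b : ℝ) {M : ℝ} (hM : m * (1 - l)⁻¹ ≤ M) :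
    cell m g l k a b ⊆ Icc a (a + M * g ^ k) ×ˢ Icc b (b + M * l ^ k) := by
  rintro _ ⟨_, ⟨ω, rfl⟩, rfl⟩
  have h1 := digit_bound ω hg (hgl.trans hl)
  have h2 := digit_bound ω (hg.trans hgl) hl
  have h3 : (1 - g)⁻¹ ≤ (1 - l)⁻¹ := inv_anti₀ (by linarith) (by linarith)
  have h4 : (m : ℝ) * (1 - g)⁻¹ ≤ m * (1 - l)⁻¹ := mul_le_mul_of_nonneg_left h3 (by positivity)
  have hgk : 0 < g ^ k := pow_pos hg k
  have hlk : 0 < l ^ k := pow_pos (hg.trans hgl) k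
  refine ⟨⟨?_, ?_⟩, ?_, ?_⟩
  · simp only; have := mul_nonneg hgk.le h1.1; linarith
  · simp only
    have := mul_le_mul_of_nonneg_left (h1.2.trans (h4.trans hM)) hgk.le; linarith
  · simp only; have := mul_nonneg hlk.le h2.1; linarith
  · simp only
    have := mul_le_mul_of_nonneg_left (h2.2.trans hM) hlk.le; linarith

lemma cell_subset_cells {m : ℕ} {g l : ℝ} (hg : 0 < g) (hgl : g < l) (hl : l < 1)
    (k n : ℕ) (a b : ℝ) :
    cell m g l k a b ⊆ ⋃ u : Fin n → Fin m,
      cell m g l (k + n) (a + g ^ k * wval u g) (b + l ^ k * wval u l) := by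
  rintro _ ⟨_, ⟨ω, rfl⟩, rfl⟩
  simp only [mem_iUnion]
  refine ⟨fun i => ω i, _, ⟨fun i => ω (i + n), rfl⟩, ?_⟩
  simp only
  rw [digit_split_s19 ω hg (hgl.trans hl) n, digit_split_s19 ω (hg.trans hgl) hl n]
  refine Prod.ext ?_ ?_ <;> simp only <;> ring

lemma hcont_zero {m : ℕ} (hm : 2 ≤ m) {s g l : ℝ} (hs : 0 < s) (hg : 0 < g) (hgl : g < l)
    (hl : l < 1) (hrel : (m : ℝ) * l * g ^ s = g) (hclose : ∀ ε > 0, Close m g l ε) :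
    hcont s hs (Kaff m (fun i => (i.1 : ℝ)) g l) = 0 := by
  have hl0 := hg.trans hgl
  have hm0 : (0 : ℝ) < m := by positivity
  set M : ℝ := m * (1 - l)⁻¹ + 2 with hM
  have hMpos : 0 < M := by
    have : 0 < (1 - l)⁻¹ := inv_pos.2 (by linarith)
    positivity
  set C : ℝ≥0∞ := ENNReal.ofReal (2 * M ^ s) with hC
  have hCtop : C ≠ ∞ := ENNReal.ofReal_ne_top
  have hmE : ∀ k : ℕ, (m : ℝ≥0∞) ^ k * ENNReal.ofReal (2 * M ^ s * (1 / (m : ℝ)) ^ k) = C := by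
    intro k
    rw [← ENNReal.ofReal_natCast, ← ENNReal.ofReal_pow hm0.le, ← ENNReal.ofReal_mul (by positivity)]
    congr 1
    rw [one_div, inv_pow]
    field_simp
  have hrect : ∀ k a b, (m : ℝ≥0∞) ^ k * hcont s hs
      (Icc a (a + M * g ^ k) ×ˢ Icc b (b + M * l ^ k)) ≤ C := by
    intro k a b
    rw [← hmE k]
    gcongr
    exact hcont_rect m hm hs hg hgl hrel hMpos a b k
  set S : ℝ≥0∞ := ⨆ (k : ℕ) (a : ℝ) (b : ℝ), (m : ℝ≥0∞) ^ k * hcont s hs (cell m g l k a b) with hS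
  have hSC : S ≤ C := by
    refine iSup_le fun k => iSup_le fun a => iSup_le fun b => le_trans ?_ (hrect k a b)
    gcongr
    exact cell_subset_rect hg hgl hl k a b (by linarith)
  have hle : ∀ k a b, (m : ℝ≥0∞) ^ k * hcont s hs (cell m g l k a b) ≤ S := fun k a b =>
    le_iSup_of_le k (le_iSup_of_le a (le_iSup_of_le b le_rfl))
  have hSfinite : S ≠ ∞ := ne_top_of_le_ne_top hCtop hSC
  have hN : ∀ N : ℕ, (2 : ℝ≥0∞) ^ N * S ≤ C := by
    intro N
    obtain ⟨n, U, hU, hUc⟩ := cluster hg hl0 hclose N 1 one_pos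
    have hUne : U.Nonempty := by
      rw [← Finset.card_pos, hU]; positivity
    obtain ⟨u₀, hu₀⟩ := hUne
    have step : ∀ k a b, (m : ℝ≥0∞) ^ (k + n) * hcont s hs (cell m g l k a b) ≤
        C + ((Uᶜ).card : ℝ≥0∞) * S := by
      intro k a b
      have hsub : cell m g l k a b ⊆
          (Icc (a + g ^ k * wval u₀ g - g ^ (k + n)) (a + g ^ k * wval u₀ g - g ^ (k + n) + M * g ^ (k + n)) ×ˢ
           Icc (b + l ^ k * wval u₀ l - l ^ (k + n)) (b + l ^ k * wval u₀ l - l ^ (k + n) + M * l ^ (k + n))) ∪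
          ⋃ u ∈ Uᶜ, cell m g l (k + n) (a + g ^ k * wval u g) (b + l ^ k * wval u l) := by
        refine (cell_subset_cells hg hgl hl k n a b).trans ?_
        refine iUnion_subset fun u => ?_
        by_cases hu : u ∈ U
        · refine subset_union_of_subset_left ?_ _
          refine (cell_subset_rect hg hgl hl (k + n) _ _ le_rfl).trans ?_
          have hx : ∀ x : ℝ, 0 < x → ∀ a, |wval u x - wval u₀ x| ≤ 1 * x ^ n →
              Icc (a + x ^ k * wval u x) (a + x ^ k * wval u x + m * (1 - l)⁻¹ * x ^ (k + n)) ⊆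
              Icc (a + x ^ k * wval u₀ x - x ^ (k + n))
                (a + x ^ k * wval u₀ x - x ^ (k + n) + M * x ^ (k + n)) := by
            intro x hx a h
            have hk : 0 < x ^ k := pow_pos hx k
            rw [abs_le] at h
            have h1 := mul_le_mul_of_nonneg_left h.1 hk.le
            have h2 := mul_le_mul_of_nonneg_left h.2 hk.le
            rw [hM, pow_add]
            refine Icc_subset_Icc ?_ ?_ <;> nlinarith
          exact prod_mono (hx g hg a (hUc u hu u₀ hu₀).1) (hx l hl0 b (hUc u hu u₀ hu₀).2)
        · refine subset_union_of_subset_right ?_ _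
          exact subset_biUnion_of_mem (u := fun u => cell m g l (k + n) (a + g ^ k * wval u g) (b + l ^ k * wval u l)) (Finset.mem_compl.2 hu)
      calc _ ≤ (m : ℝ≥0∞) ^ (k + n) * (hcont s hs _ + ∑ u ∈ Uᶜ, hcont s hs
              (cell m g l (k + n) (a + g ^ k * wval u g) (b + l ^ k * wval u l))) := by
            gcongr
            exact (measure_mono hsub).trans ((measure_union_le _ _).trans
              (add_le_add le_rfl (measure_biUnion_finset_le _ _)))
        _ ≤ _ := by
            rw [mul_add, Finset.mul_sum]
            refine add_le_add (hrect _ _ _) ?_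
            refine (Finset.sum_le_sum fun u _ => hle _ _ _).trans ?_
            rw [Finset.sum_const, nsmul_eq_mul]
    have hmS : (m : ℝ≥0∞) ^ n * S ≤ C + ((Uᶜ).card : ℝ≥0∞) * S := by
      have hSm : (m : ℝ≥0∞) ^ n * S = ⨆ (k : ℕ) (a : ℝ) (b : ℝ),
          (m : ℝ≥0∞) ^ n * ((m : ℝ≥0∞) ^ k * hcont s hs (cell m g l k a b)) := by
        rw [hS]; simp only [ENNReal.mul_iSup]
      rw [hSm]
      refine iSup_le fun k => iSup_le fun a => iSup_le fun b => ?_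
      refine le_trans (le_of_eq ?_) (step k a b)
      rw [pow_add]; ring
    have hcard : ((U.card : ℝ≥0∞) + ((Uᶜ).card : ℝ≥0∞)) = (m : ℝ≥0∞) ^ n := by
      have := Finset.card_add_card_compl U
      rw [Fintype.card_fun, Fintype.card_fin, Fintype.card_fin] at this
      exact_mod_cast this
    rw [← hcard, add_mul, hU] at hmS
    have hfin : ((Uᶜ).card : ℝ≥0∞) * S ≠ ∞ := ENNReal.mul_ne_top (by simp) hSfinite
    have := (ENNReal.add_le_add_iff_right hfin).1 hmS
    exact_mod_cast this
  have hS0 : S = 0 := by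
    by_contra h
    have : Tendsto (fun N : ℕ => (2 : ℝ≥0∞) ^ N * S) atTop (𝓝 ∞) := by
      have h2 : Tendsto (fun N : ℕ => (2 : ℝ≥0∞) ^ N) atTop (𝓝 ∞) :=
        ENNReal.tendsto_pow_atTop_nhds_top_iff.2 (by norm_num)
      have := ENNReal.Tendsto.mul_const (b := S) h2 (Or.inl (by simp))
      rwa [ENNReal.top_mul h] at this
    have := le_of_tendsto' this hN
    exact hCtop (top_le_iff.1 this)
  have h0 := hle 0 0 0
  rw [hS0] at h0
  have hcell : cell m g l 0 0 0 = Kaff m (fun i => (i.1 : ℝ)) g l := by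
    simp [cell]
  rw [hcell] at h0
  simpa using h0

/-- One-dimensional consequence of the Lebesgue density theorem. -/
lemma thick_ae (A : Set ℝ) (hA : MeasurableSet A) (K : ℕ) : ∀ᵐ x : ℝ, x ∈ A →
    ∃ k : ℕ, ∀ z δ : ℝ, 0 < δ → δ < 1 / ((k : ℝ) + 1) → |x - z| < K * δ →
      ∃ x' ∈ A, |x' - z| ≤ δ := by
  have h := IsUnifLocDoublingMeasure.ae_tendsto_measure_inter_div (μ := (volume : Measure ℝ)) A K
  rw [ae_restrict_iff' hA] at h
  filter_upwards [h] with x hx hxA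
  by_contra! hcon
  choose z δ hδ0 hδ1 hz hempty using hcon
  have hlim : Tendsto δ atTop (𝓝[>] 0) := by
    refine tendsto_nhdsWithin_iff.2 ⟨?_, Eventually.of_forall hδ0⟩
    exact squeeze_zero (fun k => (hδ0 k).le) (fun k => (hδ1 k).le)
      tendsto_one_div_add_atTop_nhds_zero_nat
  have ht := hx hxA (ι := ℕ) (l := atTop) z δ hlim (Eventually.of_forall fun k => by
    rw [Metric.mem_closedBall, Real.dist_eq]; exact (hz k).le)
  have h0 : ∀ k, A ∩ Metric.closedBall (z k) (δ k) = ∅ := by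
    intro k
    rw [eq_empty_iff_forall_notMem]
    rintro y ⟨hy, hy'⟩
    rw [Metric.mem_closedBall, Real.dist_eq] at hy'
    exact absurd hy' (not_le.2 (hempty k y hy))
  simp only [h0, measure_empty, ENNReal.zero_div] at ht
  exact zero_ne_one (tendsto_nhds_unique tendsto_const_nhds ht)

/-- Points of `E` at which the vertical slice is thick below scale `1/(k+1)`. -/
def thickV (K : ℕ) (E : Set (ℝ × ℝ)) (k : ℕ) : Set (ℝ × ℝ) :=
  {p | p ∈ E ∧ ∀ z δ : ℝ, 0 < δ → δ < 1 / ((k : ℝ) + 1) → |p.2 - z| < K * δ →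
      ∃ y', (p.1, y') ∈ E ∧ |y' - z| ≤ δ}

lemma thickV_compact (K : ℕ) {E : Set (ℝ × ℝ)} (hE : IsCompact E) (k : ℕ) :
    IsCompact (thickV K E k) := by
  have : thickV K E k = E ∩ ⋂ (z : ℝ) (δ : ℝ) (_ : 0 < δ) (_ : δ < 1 / ((k : ℝ) + 1)),
      ({p : ℝ × ℝ | K * δ ≤ |p.2 - z|} ∪
        Prod.fst ⁻¹' (Prod.fst '' (E ∩ {p : ℝ × ℝ | |p.2 - z| ≤ δ}))) := by
    ext p
    simp only [thickV, mem_ofPred_eq, mem_inter_iff, mem_iInter, mem_union, mem_preimage, mem_image]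
    refine and_congr_right fun _ => forall_congr' fun z => forall_congr' fun δ =>
      forall_congr' fun _ => forall_congr' fun _ => ?_
    constructor
    · intro h
      rcases le_or_gt (K * δ) |p.2 - z| with h' | h'
      · exact Or.inl h'
      · obtain ⟨y', h1, h2⟩ := h h'
        exact Or.inr ⟨(p.1, y'), ⟨h1, h2⟩, rfl⟩
    · rintro (h | ⟨q, ⟨h1, h2⟩, h3⟩) h'
      · exact absurd h' (not_lt.2 h)
      · exact ⟨q.2, by rw [← h3]; exact h1, h2⟩
  rw [this]
  refine hE.inter_right ?_
  refine isClosed_iInter fun z => isClosed_iInter fun δ => isClosed_iInter fun _ =>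
    isClosed_iInter fun _ => IsClosed.union ?_ ?_
  · exact isClosed_le continuous_const (by fun_prop)
  · refine IsClosed.preimage continuous_fst (IsCompact.isClosed (IsCompact.image ?_ continuous_fst))
    exact hE.inter_right (isClosed_le (by fun_prop) continuous_const)

lemma thickV_ae (K : ℕ) {E : Set (ℝ × ℝ)} (hE : IsCompact E) :
    ∀ᵐ p : ℝ × ℝ, p ∈ E → ∃ k, p ∈ thickV K E k := by
  have hmeas : MeasurableSet (E \ ⋃ k, thickV K E k) :=
    hE.measurableSet.diff (MeasurableSet.iUnion fun k => (thickV_compact K hE k).measurableSet)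
  have hnull : volume (E \ ⋃ k, thickV K E k) = 0 := by
    rw [Measure.volume_eq_prod, Measure.measure_prod_null hmeas]
    refine Eventually.of_forall fun x => ?_
    have hA : MeasurableSet (Prod.mk x ⁻¹' E) := measurable_prodMk_left hE.measurableSet
    have := thick_ae (Prod.mk x ⁻¹' E) hA K
    refine measure_mono_null ?_ this
    intro y hy hcon
    obtain ⟨hyE, hy2⟩ := hy
    obtain ⟨k, hk⟩ := hcon hyE
    exact hy2 (mem_iUnion.2 ⟨k, hyE, hk⟩)
  rw [ae_iff]
  refine measure_mono_null ?_ hnull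
  intro p hp
  simp only [mem_ofPred_eq, Classical.not_imp] at hp
  exact ⟨hp.1, fun h => hp.2 (mem_iUnion.1 h)⟩

/-- A two-dimensional substitute of the strong density theorem. -/
lemma thick_both {E : Set (ℝ × ℝ)} (hE : IsCompact E) :
    ∀ᵐ p : ℝ × ℝ, p ∈ E → ∀ K : ℕ, ∃ r > 0, ∀ z₁ δ₁ z₂ δ₂ : ℝ, 0 < δ₁ → δ₁ < r → 0 < δ₂ → δ₂ < r →
      |p.1 - z₁| < K * δ₁ → |p.2 - z₂| < K * δ₂ →
      ∃ q ∈ E, |q.1 - z₁| ≤ δ₁ ∧ |q.2 - z₂| ≤ δ₂ := by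
  have hsw : ∀ (K k : ℕ), ∀ᵐ p : ℝ × ℝ, p ∈ thickV K E k →
      ∃ j, p.swap ∈ thickV K (Prod.swap '' thickV K E k) j := by
    intro K k
    have hc : IsCompact (Prod.swap '' thickV K E k) :=
      (thickV_compact K hE k).image continuous_swap
    have h := thickV_ae K hc
    have hq : Measure.QuasiMeasurePreserving (Prod.swap : ℝ × ℝ → ℝ × ℝ) volume volume :=
      (Measure.measurePreserving_swap (μ := (volume : Measure ℝ))
        (ν := (volume : Measure ℝ))).quasiMeasurePreserving
    filter_upwards [hq.ae h] with p hp hpE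
    exact hp ⟨p, hpE, rfl⟩
  have h1 : ∀ᵐ p : ℝ × ℝ, ∀ K, p ∈ E → ∃ k, p ∈ thickV K E k :=
    ae_all_iff.2 fun K => thickV_ae K hE
  have h2 : ∀ᵐ p : ℝ × ℝ, ∀ K k, p ∈ thickV K E k →
      ∃ j, p.swap ∈ thickV K (Prod.swap '' thickV K E k) j :=
    ae_all_iff.2 fun K => ae_all_iff.2 fun k => hsw K k
  filter_upwards [h1, h2] with p hp1 hp2 hpE K
  obtain ⟨k, hk⟩ := hp1 K hpE
  obtain ⟨j, hj⟩ := hp2 K k hk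
  refine ⟨min (1 / ((k : ℝ) + 1)) (1 / ((j : ℝ) + 1)), by positivity, ?_⟩
  intro z₁ δ₁ z₂ δ₂ h10 h1r h20 h2r hz1 hz2
  obtain ⟨x', hx', hx'z⟩ := hj.2 z₁ δ₁ h10 (h1r.trans_le (min_le_right _ _)) hz1
  obtain ⟨q, hq, hqe⟩ := hx'
  have e1 : q.2 = p.2 := congrArg Prod.fst hqe
  have e2 : q.1 = x' := congrArg Prod.snd hqe
  obtain ⟨y', hy', hy'z⟩ := hq.2 z₂ δ₂ h20 (h2r.trans_le (min_le_left _ _)) (by rw [e1]; exact hz2)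
  exact ⟨(q.1, y'), hy', by simpa [e2] using hx'z, hy'z⟩

/-- Truncation of a power series. -/
def trunc (c : ℕ → ℝ) (n : ℕ) (x : ℝ) : ℝ := ∑ i ∈ Finset.range n, c i * x ^ i

lemma trunc_contDiff (c : ℕ → ℝ) (n : ℕ) : ContDiff ℝ 1 (trunc c n) := by
  unfold trunc; fun_prop

lemma trunc_lip {c : ℕ → ℝ} {M : ℝ} (hc : ∀ i, |c i| ≤ M) {r : ℝ} (hr0 : 0 ≤ r) (hr : r < 1)
    {N n : ℕ} (hn : N ≤ n) {x y : ℝ} (hx : |x| ≤ r) (hy : |y| ≤ r) :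
    |(trunc c n x - trunc c n y) - (trunc c N x - trunc c N y)| ≤
      M * (∑' i, ((i + N : ℕ) : ℝ) * r ^ (i + N - 1)) * |x - y| := by
  have hM : 0 ≤ M := (abs_nonneg _).trans (hc 0)
  have hsum : Summable (fun i : ℕ => (i : ℝ) * r ^ (i - 1)) := by
    rw [← summable_nat_add_iff 1]
    have h1 : Summable (fun i : ℕ => (i : ℝ) ^ 1 * r ^ i) :=
      summable_pow_mul_geometric_of_norm_lt_one 1 (by rwa [Real.norm_eq_abs, abs_of_nonneg hr0])
    have h2 := h1.add (summable_geometric_of_lt_one hr0 hr)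
    refine h2.congr fun i => ?_
    simp; ring
  have h1 : (trunc c n x - trunc c n y) - (trunc c N x - trunc c N y) =
      ∑ i ∈ Finset.range (n - N), c (i + N) * (x ^ (i + N) - y ^ (i + N)) := by
    obtain ⟨k, rfl⟩ := Nat.exists_eq_add_of_le hn
    simp only [trunc, Finset.sum_range_add, Nat.add_sub_cancel_left]
    rw [add_sub_add_comm, add_sub_cancel_left, ← Finset.sum_sub_distrib]
    refine Finset.sum_congr rfl fun i _ => ?_
    rw [add_comm N i]; ring
  rw [h1]
  refine (Finset.abs_sum_le_sum_abs _ _).trans ?_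
  have h2 : ∀ i ∈ Finset.range (n - N), |c (i + N) * (x ^ (i + N) - y ^ (i + N))| ≤
      M * |x - y| * (((i + N : ℕ) : ℝ) * r ^ (i + N - 1)) := by
    intro i _
    rw [abs_mul]
    have h3 := abs_pow_sub_pow_le x y (i + N)
    have h4 : max |x| |y| ^ (i + N - 1) ≤ r ^ (i + N - 1) :=
      pow_le_pow_left₀ (le_max_of_le_left (abs_nonneg _)) (max_le hx hy) _
    calc _ ≤ M * (|x - y| * ((i + N : ℕ) : ℝ) * max |x| |y| ^ (i + N - 1)) :=
          mul_le_mul (hc _) h3 (abs_nonneg _) hM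
      _ ≤ M * (|x - y| * ((i + N : ℕ) : ℝ) * r ^ (i + N - 1)) := by gcongr
      _ = _ := by ring
  refine (Finset.sum_le_sum h2).trans ?_
  rw [← Finset.mul_sum, mul_right_comm M _ |x - y|]
  refine mul_le_mul_of_nonneg_left ?_ (mul_nonneg hM (abs_nonneg _))
  exact Summable.sum_le_tsum _ (fun i _ => by positivity) ((summable_nat_add_iff N).2 hsum)

lemma tail_tendsto {r : ℝ} : Tendsto
    (fun N : ℕ => ∑' i, ((i + N : ℕ) : ℝ) * r ^ (i + N - 1)) atTop (𝓝 0) :=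
  tendsto_sum_nat_add (fun i : ℕ => (i : ℝ) * r ^ (i - 1))

lemma series_summable {c : ℕ → ℝ} {M : ℝ} (hc : ∀ i, |c i| ≤ M) {x : ℝ} (hx : |x| < 1) :
    Summable (fun i => c i * x ^ i) := by
  refine Summable.of_norm_bounded (g := fun i => M * |x| ^ i)
    ((summable_geometric_of_lt_one (abs_nonneg x) hx).mul_left M) fun i => ?_
  rw [Real.norm_eq_abs, abs_mul, abs_pow]
  exact mul_le_mul_of_nonneg_right (hc i) (by positivity)

lemma trunc_tendsto {c : ℕ → ℝ} {M : ℝ} (hc : ∀ i, |c i| ≤ M) {x : ℝ} (hx : |x| < 1) :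
    Tendsto (fun n => trunc c n x) atTop (𝓝 (Beval c x)) :=
  (series_summable hc hx).hasSum.tendsto_sum_nat

lemma trunc_approx {c : ℕ → ℝ} {M : ℝ} (hc : ∀ i, |c i| ≤ M) {g : ℝ} (hg : 0 < g) (hg1 : g < 1)
    (hΔ : deriv (Beval c) g ≠ 0) : ∃ δ > 0, ∀ᶠ n in atTop, ∀ x y, |x - g| ≤ δ → |y - g| ≤ δ →
      |trunc c n x - trunc c n y - deriv (Beval c) g * (x - y)| ≤
        |deriv (Beval c) g| / 2 * |x - y| := by
  set Δ := deriv (Beval c) g with hΔd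
  have hdf : HasDerivAt (Beval c) Δ g := (differentiableAt_of_deriv_ne_zero hΔ).hasDerivAt
  set r := (g + 1) / 2 with hr
  have hr0 : 0 ≤ r := by rw [hr]; linarith
  have hr1 : r < 1 := by rw [hr]; linarith
  set τ : ℕ → ℝ := fun N => M * ∑' i, ((i + N : ℕ) : ℝ) * r ^ (i + N - 1) with hτ
  have hτ0 : Tendsto τ atTop (𝓝 0) := by
    have := (tail_tendsto (r := r)).const_mul M
    rwa [mul_zero] at this
  have hΔ' : 0 < |Δ| := abs_pos.2 hΔ
  obtain ⟨N, hN⟩ := (hτ0.eventually (gt_mem_nhds (show 0 < |Δ| / 8 by positivity))).exists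
  have hnear : ∀ x, |x - g| ≤ min g ((1 - g) / 2) → |x| ≤ r := by
    intro x hx
    have h1 := hx.trans (min_le_left _ _)
    have h2 := hx.trans (min_le_right _ _)
    rw [abs_le] at h1 h2 ⊢
    rw [hr]
    constructor <;> linarith
  have hf : ∀ x y, |x| ≤ r → |y| ≤ r →
      |(Beval c x - Beval c y) - (trunc c N x - trunc c N y)| ≤ τ N * |x - y| := by
    intro x y hx hy
    have ht := (((trunc_tendsto hc (hx.trans_lt hr1)).sub
      (trunc_tendsto hc (hy.trans_lt hr1))).sub_const (trunc c N x - trunc c N y)).abs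
    refine le_of_tendsto ht ?_
    filter_upwards [eventually_ge_atTop N] with n hn
    exact trunc_lip hc hr0 hr1 hn hx hy
  have hst : HasStrictDerivAt (trunc c N) (deriv (trunc c N) g) g :=
    (trunc_contDiff c N).contDiffAt.hasStrictDerivAt (by norm_num)
  set P := deriv (trunc c N) g
  have hmin : 0 < min g ((1 - g) / 2) := lt_min hg (by linarith)
  have hP : |Δ - P| ≤ |Δ| / 8 := by
    have hd : HasDerivAt (fun x => Beval c x - trunc c N x) (Δ - P) g := hdf.sub hst.hasDerivAt
    have := hd.le_of_lip' (C := |Δ| / 8) (by positivity) (by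
      filter_upwards [Metric.closedBall_mem_nhds g hmin] with x hx
      rw [Metric.mem_closedBall, Real.dist_eq] at hx
      have h1 := hf x g (hnear x hx) (hnear g (by simpa using hmin.le))
      rw [Real.norm_eq_abs, Real.norm_eq_abs]
      calc _ = |(Beval c x - Beval c g) - (trunc c N x - trunc c N g)| := by congr 1; ring
        _ ≤ _ := h1
        _ ≤ _ := mul_le_mul_of_nonneg_right hN.le (abs_nonneg _))
    simpa using this
  have hlo := hst.hasStrictFDerivAt.isLittleO.bound (show 0 < |Δ| / 8 by positivity)
  rw [nhds_prod_eq] at hlo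
  obtain ⟨s, hs, hsb⟩ := (Filter.eventually_prod_self_iff'.1 hlo)
  obtain ⟨δ, hδ, hδs⟩ := Metric.nhds_basis_closedBall.mem_iff.1 hs
  refine ⟨min δ (min g ((1 - g) / 2)), lt_min hδ hmin, ?_⟩
  filter_upwards [eventually_ge_atTop N] with n hn x y hx hy
  have hx1 := hnear x (hx.trans (min_le_right _ _))
  have hy1 := hnear y (hy.trans (min_le_right _ _))
  have b1 := (trunc_lip hc hr0 hr1 hn hx1 hy1).trans
    (mul_le_mul_of_nonneg_right hN.le (abs_nonneg (x - y)))
  have b2 : |trunc c N x - trunc c N y - (x - y) * P| ≤ |Δ| / 8 * |x - y| := by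
    have := hsb x (hδs (by rw [Metric.mem_closedBall, Real.dist_eq]; exact hx.trans (min_le_left _ _)))
      y (hδs (by rw [Metric.mem_closedBall, Real.dist_eq]; exact hy.trans (min_le_left _ _)))
    simpa using this
  have b3 : |(P - Δ) * (x - y)| ≤ |Δ| / 8 * |x - y| := by
    rw [abs_mul, abs_sub_comm P Δ]
    exact mul_le_mul_of_nonneg_right hP (abs_nonneg _)
  have hid : trunc c n x - trunc c n y - Δ * (x - y) =
      ((trunc c n x - trunc c n y) - (trunc c N x - trunc c N y)) +
      (trunc c N x - trunc c N y - (x - y) * P) + (P - Δ) * (x - y) := by ring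
  rw [hid]
  have h0 : 0 ≤ |Δ| * |x - y| := by positivity
  refine (abs_add_le _ _).trans ((add_le_add (abs_add_le _ _) le_rfl).trans ?_)
  linarith

lemma trunc_small {c : ℕ → ℝ} {M : ℝ} (hc : ∀ i, |c i| ≤ M) {g : ℝ} (hg : 0 < g) (hg1 : g < 1)
    (h0 : Beval c g = 0) (n : ℕ) : |trunc c n g| ≤ M * (1 - g)⁻¹ * g ^ n := by
  have hs := series_summable hc (x := g) (by rwa [abs_of_pos hg])
  have h1 := hs.sum_add_tsum_nat_add n
  have h2 : trunc c n g = -∑' i, c (i + n) * g ^ (i + n) := by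
    have : Beval c g = ∑' i, c i * g ^ i := rfl
    rw [← this, h0] at h1
    unfold trunc; linarith
  rw [h2, abs_neg]
  have hgeo := (hasSum_geometric_of_lt_one hg.le hg1).mul_left (M * g ^ n)
  have := tsum_of_norm_bounded (f := fun i => c (i + n) * g ^ (i + n)) hgeo (fun i => by
    rw [Real.norm_eq_abs, abs_mul, abs_of_pos (pow_pos hg _), pow_add]
    have := mul_le_mul_of_nonneg_right (hc (i + n)) (show 0 ≤ g ^ i * g ^ n by positivity)
    linarith)
  rw [Real.norm_eq_abs] at this
  linarith

lemma root_lemma {c : ℕ → ℝ} {M : ℝ} (hc : ∀ i, |c i| ≤ M) {g : ℝ} (hg : 0 < g) (hg1 : g < 1)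
    (h0 : Beval c g = 0) (hΔ : deriv (Beval c) g ≠ 0) {ε : ℝ} (hε : 0 < ε) :
    ∃ κ > 0, ∃ K : ℕ, ∀ᶠ n in atTop, ∃ z, |g - z| < K * (κ * g ^ n) ∧
      ∀ x, |x - z| ≤ κ * g ^ n → |trunc c n x| < ε * x ^ n := by
  obtain ⟨δ, hδ, happ⟩ := trunc_approx hc hg hg1 hΔ
  set Δ := deriv (Beval c) g
  have hΔ' : 0 < |Δ| := abs_pos.2 hΔ
  have hM : 0 ≤ M := (abs_nonneg _).trans (hc 0)
  set B := M * (1 - g)⁻¹ with hB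
  have hB0 : 0 ≤ B := mul_nonneg hM (inv_nonneg.2 (by linarith))
  set κ := ε / (4 * |Δ|) with hκ
  have hκ0 : 0 < κ := by positivity
  set W := 2 * B / |Δ| with hW
  have hW0 : 0 ≤ W := by positivity
  obtain ⟨K, hK⟩ := exists_nat_gt (W / κ)
  refine ⟨κ, hκ0, K, ?_⟩
  have e1 : ∀ᶠ n : ℕ in atTop, (W + κ) * g ^ n < δ := by
    have : Tendsto (fun n : ℕ => (W + κ) * g ^ n) atTop (𝓝 ((W + κ) * 0)) :=
      (tendsto_pow_atTop_nhds_zero_of_lt_one hg.le hg1).const_mul _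
    rw [mul_zero] at this
    exact this.eventually (gt_mem_nhds hδ)
  have e2 : ∀ᶠ n : ℕ in atTop, (W + κ) / g * (n * g ^ n) < 1 / 2 := by
    have : Tendsto (fun n : ℕ => (W + κ) / g * (n * g ^ n)) atTop (𝓝 ((W + κ) / g * 0)) :=
      (tendsto_self_mul_const_pow_of_lt_one hg.le hg1).const_mul _
    rw [mul_zero] at this
    exact this.eventually (gt_mem_nhds (by norm_num))
  have e3 : ∀ᶠ n : ℕ in atTop, (W + κ) * g ^ n < g := by
    have : Tendsto (fun n : ℕ => (W + κ) * g ^ n) atTop (𝓝 ((W + κ) * 0)) :=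
      (tendsto_pow_atTop_nhds_zero_of_lt_one hg.le hg1).const_mul _
    rw [mul_zero] at this
    exact this.eventually (gt_mem_nhds hg)
  filter_upwards [happ, e1, e2, e3] with n hn h1 h2 h3
  have hgn : 0 < g ^ n := pow_pos hg n
  have hWn : 0 ≤ W * g ^ n := by positivity
  have hκn : 0 < κ * g ^ n := by positivity
  rw [add_mul] at h1 h3
  -- normalised function
  have hH : ∀ x y, |x - g| ≤ δ → |y - g| ≤ δ →
      |trunc c n x / Δ - trunc c n y / Δ - (x - y)| ≤ 1 / 2 * |x - y| := by
    intro x y hx hy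
    have := hn x y hx hy
    have e : trunc c n x / Δ - trunc c n y / Δ - (x - y) =
      (trunc c n x - trunc c n y - Δ * (x - y)) / Δ := by field_simp
    rw [e, abs_div, div_le_iff₀ hΔ']
    linarith
  have hsmall : |trunc c n g / Δ| ≤ W * g ^ n / 2 := by
    rw [abs_div, div_le_iff₀ hΔ']
    have := trunc_small hc hg hg1 h0 n
    have e : W * g ^ n / 2 * |Δ| = B * g ^ n := by rw [hW]; field_simp
    rw [e]; exact this
  have hcont : Continuous (fun x => trunc c n x / Δ) := (trunc_contDiff c n).continuous.div_const _
  have hgδ : |g - g| ≤ δ := by simpa using hδ.le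
  obtain ⟨z, hz, hz0⟩ : ∃ z ∈ Icc (g - W * g ^ n) (g + W * g ^ n), trunc c n z / Δ = 0 := by
    have hp := hH (g + W * g ^ n) g (by rw [add_sub_cancel_left, abs_of_nonneg hWn]; linarith) hgδ
    have hq := hH (g - W * g ^ n) g (by
      rw [sub_sub_cancel_left, abs_neg, abs_of_nonneg hWn]; linarith) hgδ
    rw [add_sub_cancel_left, abs_of_nonneg hWn, abs_le] at hp
    rw [sub_sub_cancel_left, abs_neg, abs_of_nonneg hWn, abs_le] at hq
    rw [abs_le] at hsmall
    have := intermediate_value_Icc (show g - W * g ^ n ≤ g + W * g ^ n by linarith)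
      hcont.continuousOn
    exact this ⟨by linarith, by linarith⟩
  have hzg : |g - z| ≤ W * g ^ n := by
    rw [abs_le]; constructor <;> linarith [hz.1, hz.2]
  refine ⟨z, ?_, ?_⟩
  · refine hzg.trans_lt ?_
    rw [← mul_assoc]
    refine mul_lt_mul_of_pos_right ?_ hgn
    rwa [div_lt_iff₀ hκ0] at hK
  · intro x hx
    rw [abs_le] at hzg
    have hx' := abs_le.1 hx
    have hxg : |x - g| ≤ δ := by
      rw [abs_le]; constructor <;> linarith
    have hzgδ : |z - g| ≤ δ := by
      rw [abs_le]; constructor <;> linarith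
    have hb := hH x z hxg hzgδ
    rw [hz0, sub_zero] at hb
    have hb2 : |trunc c n x / Δ| ≤ 3 / 2 * (κ * g ^ n) := by
      have := abs_sub_abs_le_abs_sub (trunc c n x / Δ) (x - z)
      linarith
    rw [abs_div, div_le_iff₀ hΔ'] at hb2
    have hκe : 3 / 2 * (κ * g ^ n) * |Δ| = 3 / 8 * ε * g ^ n := by
      rw [hκ]; field_simp; ring
    rw [hκe] at hb2
    have hxn : g ^ n / 2 ≤ x ^ n := by
      have hxlow : -1 ≤ (x - g) / g := by
        rw [le_div_iff₀ hg]; linarith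
      have hber := one_add_mul_le_pow (show -2 ≤ (x - g) / g by linarith) n
      have e : 1 + (x - g) / g = x / g := by field_simp; ring
      rw [e, div_pow, le_div_iff₀ hgn] at hber
      have hlow : -((W + κ) / g * g ^ n) ≤ (x - g) / g := by
        rw [le_div_iff₀ hg]
        have : -((W + κ) / g * g ^ n) * g = -((W + κ) * g ^ n) := by field_simp
        rw [this]; linarith
      have := mul_le_mul_of_nonneg_left hlow (Nat.cast_nonneg n : (0 : ℝ) ≤ n)
      have hhalf : 1 / 2 ≤ 1 + (n : ℝ) * ((x - g) / g) := by
        have e' : (n : ℝ) * -((W + κ) / g * g ^ n) = -((W + κ) / g * (n * g ^ n)) := by ring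
        linarith
      have := mul_le_mul_of_nonneg_right hhalf hgn.le
      linarith
    have := mul_le_mul_of_nonneg_left hxn hε.le
    have hpos : 0 < ε * g ^ n := by positivity
    linarith

lemma wval_sub {m : ℕ} (a b : ℕ → Fin m) {c : ℕ → ℝ} (h : ∀ n, c n = ((a n).1 : ℝ) - ((b n).1 : ℝ))
    (n : ℕ) (x : ℝ) :
    wval (fun i : Fin n => a i) x - wval (fun i : Fin n => b i) x = trunc c n x := by
  rw [wval, wval, trunc, Finset.sum_range, ← Finset.sum_sub_distrib]
  refine Finset.sum_congr rfl fun i _ => ?_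
  rw [h]; ring

lemma isOpen_close (m : ℕ) (ε : ℝ) : IsOpen {p : ℝ × ℝ | Close m p.1 p.2 ε} := by
  have hw : ∀ {n : ℕ} (u : Fin n → Fin m), Continuous (wval u) := by
    intro n u; unfold wval; fun_prop
  have : {p : ℝ × ℝ | Close m p.1 p.2 ε} = ⋃ (n : ℕ) (u : Fin n → Fin m) (v : Fin n → Fin m)
      (_ : u ≠ v), ({p : ℝ × ℝ | |wval u p.1 - wval v p.1| < ε * p.1 ^ n} ∩
        {p : ℝ × ℝ | |wval u p.2 - wval v p.2| < ε * p.2 ^ n}) := by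
    ext p
    simp only [Close, mem_ofPred_eq, mem_iUnion, mem_inter_iff, exists_prop]
  rw [this]
  refine isOpen_iUnion fun n => isOpen_iUnion fun u => isOpen_iUnion fun v => isOpen_iUnion fun _ =>
    IsOpen.inter ?_ ?_
  · exact isOpen_lt (((hw u).comp continuous_fst).sub ((hw v).comp continuous_fst)).abs
      (by fun_prop)
  · exact isOpen_lt (((hw u).comp continuous_snd).sub ((hw v).comp continuous_snd)).abs
      (by fun_prop)

lemma close_ae (m : ℕ) (R : Set (ℝ × ℝ)) (hR : R ⊆ Gamma m 0 (1 / m))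
    (hstar : ∀ q ∈ R, ∃ c : ℕ → ℝ, memB m (fun i => (i.1 : ℝ)) c ∧
      Beval c q.1 = 0 ∧ Beval c q.2 = 0 ∧
      deriv (Beval c) q.1 ≠ 0 ∧ deriv (Beval c) q.2 ≠ 0) {ε : ℝ} (hε : 0 < ε) :
    ∀ᵐ q : ℝ × ℝ, q ∈ R → Close m q.1 q.2 ε := by
  set E : Set (ℝ × ℝ) := (Icc 0 1 ×ˢ Icc 0 1) \ {p : ℝ × ℝ | Close m p.1 p.2 ε} with hEd
  have hE : IsCompact E := (isCompact_Icc.prod isCompact_Icc).diff (isOpen_close m ε)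
  filter_upwards [thick_both hE] with q hq hqR
  by_contra hnot
  obtain ⟨hg, hgl, hl1, -, -, -⟩ := hR hqR
  obtain ⟨c, ⟨hcm, hc0⟩, hz1, hz2, hd1, hd2⟩ := hstar q hqR
  choose a b hab using hcm
  have hcb : ∀ i, |c i| ≤ m := by
    intro i
    have h1 : ((a i).1 : ℝ) ≤ m := by exact_mod_cast (a i).2.le
    have h2 : ((b i).1 : ℝ) ≤ m := by exact_mod_cast (b i).2.le
    have h3 : (0 : ℝ) ≤ ((a i).1 : ℝ) := by positivity
    have h4 : (0 : ℝ) ≤ ((b i).1 : ℝ) := by positivity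
    rw [hab i, abs_le]; constructor <;> linarith
  have hl0 := hg.trans hgl
  have hg1 := hgl.trans hl1
  have hqE : q ∈ E := ⟨⟨⟨hg.le, hg1.le⟩, hl0.le, hl1.le⟩, hnot⟩
  obtain ⟨κ₁, hκ₁, K₁, ev1⟩ := root_lemma hcb hg hg1 hz1 hd1 hε
  obtain ⟨κ₂, hκ₂, K₂, ev2⟩ := root_lemma hcb hl0 hl1 hz2 hd2 hε
  obtain ⟨r, hr, hthick⟩ := hq hqE (max K₁ K₂)
  have hto : ∀ κ x : ℝ, 0 < x → x < 1 → ∀ᶠ n : ℕ in atTop, κ * x ^ n < r := by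
    intro κ x hx hx1
    have : Tendsto (fun n : ℕ => κ * x ^ n) atTop (𝓝 (κ * 0)) :=
      (tendsto_pow_atTop_nhds_zero_of_lt_one hx.le hx1).const_mul _
    rw [mul_zero] at this
    exact this.eventually (gt_mem_nhds hr)
  obtain ⟨n, ⟨z₁, hz₁, hs1⟩, ⟨z₂, hz₂, hs2⟩, hr1, hr2, hn⟩ := (ev1.and (ev2.and
    ((hto κ₁ q.1 hg hg1).and ((hto κ₂ q.2 hl0 hl1).and (eventually_ge_atTop 1))))).exists
  obtain ⟨p, hpE, hp1, hp2⟩ := hthick z₁ (κ₁ * q.1 ^ n) z₂ (κ₂ * q.2 ^ n) (by positivity) hr1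
    (by positivity) hr2
    (hz₁.trans_le (mul_le_mul_of_nonneg_right (by exact_mod_cast le_max_left _ _) (by positivity)))
    (hz₂.trans_le (mul_le_mul_of_nonneg_right (by exact_mod_cast le_max_right _ _) (by positivity)))
  refine hpE.2 ⟨n, fun i => a i, fun i => b i, ?_, ?_, ?_⟩
  · intro h
    have := congrFun h ⟨0, hn⟩
    simp only at this
    exact hc0 (by rw [hab 0, this, sub_self])
  · rw [wval_sub a b hab]; exact hs1 _ hp1
  · rw [wval_sub a b hab]; exact hs2 _ hp2

/-- For `D = {0,…,m−1}` and a region `R ⊆ Γ(0,1/m)` of ⋆-transversality, for a.e.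
`(γ,λ) ∈ R` the `d(γ,λ)`-dimensional Hausdorff measure of `K_{γ,λ}` vanishes, where
`d(γ,λ) = 1 + log(mλ)/log(1/γ)`. -/
theorem zero_hausdorff_measure_star_transversality
    (m : ℕ) (hm : 2 ≤ m)
    (R : Set (ℝ × ℝ)) (hR : R ⊆ Gamma m 0 (1 / m))
    (hstar : ∀ q ∈ R, ∃ c : ℕ → ℝ, memB m (fun i => (i.1 : ℝ)) c ∧
      Beval c q.1 = 0 ∧ Beval c q.2 = 0 ∧
      deriv (Beval c) q.1 ≠ 0 ∧ deriv (Beval c) q.2 ≠ 0) :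
    ∀ᵐ q : ℝ × ℝ ∂volume, q ∈ R →
      μH[1 + Real.log (m * q.2) / Real.log (1 / q.1)]
        (Kaff m (fun i => (i.1 : ℝ)) q.1 q.2) = 0 := by
  have hae : ∀ᵐ q : ℝ × ℝ, ∀ j : ℕ, q ∈ R → Close m q.1 q.2 (1 / ((j : ℝ) + 1)) :=
    ae_all_iff.2 fun j => close_ae m R hR hstar (by positivity)
  filter_upwards [hae] with q hq hqR
  obtain ⟨hg, hgl, hl1, hml, -, -⟩ := hR hqR
  have hl0 := hg.trans hgl
  have hm0 : (0 : ℝ) < m := by positivity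
  have hml' : 1 < m * q.2 := by
    rw [div_lt_iff₀ hm0] at hml; linarith
  have hlog1 : 0 < Real.log (m * q.2) := Real.log_pos hml'
  have hlog2 : 0 < Real.log (1 / q.1) := Real.log_pos (by
    rw [lt_div_iff₀ hg]; linarith)
  have hs : 0 < 1 + Real.log (m * q.2) / Real.log (1 / q.1) := by positivity
  have hrel : (m : ℝ) * q.2 * q.1 ^ (1 + Real.log (m * q.2) / Real.log (1 / q.1)) = q.1 := by
    rw [Real.rpow_add hg, Real.rpow_one]
    have : q.1 ^ (Real.log (m * q.2) / Real.log (1 / q.1)) = (m * q.2)⁻¹ := by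
      rw [Real.rpow_def_of_pos hg]
      have e : Real.log q.1 * (Real.log (m * q.2) / Real.log (1 / q.1)) = -Real.log (m * q.2) := by
        have : Real.log (1 / q.1) = - Real.log q.1 := by rw [one_div, Real.log_inv]
        rw [this] at hlog2 ⊢
        have : Real.log q.1 ≠ 0 := by intro h; rw [h] at hlog2; simp at hlog2
        field_simp
      rw [e, Real.exp_neg, Real.exp_log (by positivity)]
    rw [this]
    field_simp
  refine hausdorff_zero_of_hcont hs (hcont_zero hm hs hg hgl hl1 hrel ?_)
  intro ε hε
  obtain ⟨j, hj⟩ := exists_nat_one_div_lt hε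
  obtain ⟨n, u, v, huv, h1, h2⟩ := hq j hqR
  exact ⟨n, u, v, huv, h1.trans (mul_lt_mul_of_pos_right hj (by positivity)),
    h2.trans (mul_lt_mul_of_pos_right hj (by positivity))⟩
end
end
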